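/- arXiv:2511.18971 — 6 statements merged into one kernel-verified Lean document; each statement's English description precedes it below -/
import Mathlib

section
/- For each i ∈ {0,1}, the ratio h_i(γ) = K_i(γ)/K_{i+1}(γ) is differentiable on (0,∞) and satisfies h_i'(γ) = h_i(γ)² + (2i+1)·h_i(γ)/γ − 1 for every γ > 0. -/
open MeasureTheory Real

/-- Modified Bessel function of the second kind of integer order `j`, via the integral
representation `K_j(γ) = (2^j j! / (2j)!) · γ^{-j} · ∫_γ^∞ e^{-λ} (λ² - γ²)^{j - 1/2} dλ`. -/
noncomputable def besselK (j : ℕ) (γ : ℝ) : ℝ :=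
  ((2 : ℝ) ^ j * (Nat.factorial j) / (Nat.factorial (2 * j)) / γ ^ j) *
    ∫ l in Set.Ioi γ, Real.exp (-l) * (l ^ 2 - γ ^ 2) ^ ((j : ℝ) - 1 / 2)

/-- The ratio `h_i(γ) = K_i(γ)/K_{i+1}(γ)`. -/
noncomputable def hRatio (i : ℕ) (γ : ℝ) : ℝ := besselK i γ / besselK (i + 1) γ

open Set Filter Topology

/-- The Laplace-type integral `∫_1^∞ e^{-γu} (u² - 1)^s du`. -/
noncomputable def besselIntegral (s γ : ℝ) : ℝ :=
  ∫ u in Ioi (1 : ℝ), exp (-(γ * u)) * (u ^ 2 - 1) ^ s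

lemma sq_sub_one_pos {u : ℝ} (hu : 1 < u) : 0 < u ^ 2 - 1 := by nlinarith

lemma measurable_exp_mul_sq_sub_one_rpow (s γ : ℝ) :
    Measurable fun u : ℝ => exp (-(γ * u)) * (u ^ 2 - 1) ^ s := by
  fun_prop

lemma integrableOn_mul_exp_mul_sq_sub_one_rpow {s γ : ℝ} (hs : -1 < s) (hγ : 0 < γ) :
    IntegrableOn (fun u => u * (exp (-(γ * u)) * (u ^ 2 - 1) ^ s)) (Ioi 1) := by
  have hG : IntegrableOn (fun v : ℝ => v ^ s * exp (-(γ / 2) * v)) (Ioi 0) := by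
    simpa using integrableOn_rpow_mul_exp_neg_mul_rpow (p := 1) (b := γ / 2) hs one_pos
      (by positivity)
  have hG' : IntegrableOn (fun u : ℝ => (u - 1) ^ s * exp (-(γ / 2) * (u - 1))) (Ioi 1) := by
    have h := (measurePreserving_sub_right volume (1 : ℝ)).integrableOn_comp_preimage
      (MeasurableEquiv.subRight (1 : ℝ)).measurableEmbedding
      (f := fun v : ℝ => v ^ s * exp (-(γ / 2) * v)) (s := Ioi 0)
    simpa [Function.comp_def] using h.2 hG
  obtain ⟨n, hn⟩ := exists_nat_ge (s + 1)
  refine (hG'.const_mul (n.factorial / (γ / 2) ^ n)).mono'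
    (measurable_id.mul (measurable_exp_mul_sq_sub_one_rpow s γ)).aestronglyMeasurable ?_
  refine (ae_restrict_iff' measurableSet_Ioi).2 (Eventually.of_forall fun u (hu : 1 < u) => ?_)
  have hu0 : 0 < u - 1 := by linarith
  have hu1 : 0 < u + 1 := by linarith
  have hfac : (u ^ 2 - 1) ^ s = (u - 1) ^ s * (u + 1) ^ s := by
    rw [← mul_rpow hu0.le hu1.le]; ring_nf
  have hpow : u * (u + 1) ^ s ≤ (u + 1) ^ n := by
    calc u * (u + 1) ^ s ≤ (u + 1) * (u + 1) ^ s := by gcongr; linarith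
      _ = (u + 1) ^ (s + 1) := by rw [rpow_add_one hu1.ne', mul_comm]
      _ ≤ (u + 1) ^ (n : ℝ) := rpow_le_rpow_of_exponent_le (by linarith) hn
      _ = (u + 1) ^ n := rpow_natCast _ _
  have hexp : (u + 1) ^ n ≤ n.factorial / (γ / 2) ^ n * exp (γ / 2 * (u + 1)) := by
    have h := pow_div_factorial_le_exp (x := γ / 2 * (u + 1)) (by positivity) n
    rw [div_le_iff₀ (by positivity), mul_pow] at h
    rw [div_mul_eq_mul_div, le_div_iff₀ (by positivity)]
    linarith
  have hnn : 0 ≤ u * (exp (-(γ * u)) * (u ^ 2 - 1) ^ s) := by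
    have := sq_sub_one_pos hu
    positivity
  rw [norm_of_nonneg hnn, hfac]
  calc u * (exp (-(γ * u)) * ((u - 1) ^ s * (u + 1) ^ s))
      = (u - 1) ^ s * exp (-(γ * u)) * (u * (u + 1) ^ s) := by ring
    _ ≤ (u - 1) ^ s * exp (-(γ * u)) *
        (n.factorial / (γ / 2) ^ n * exp (γ / 2 * (u + 1))) := by
        exact mul_le_mul_of_nonneg_left (hpow.trans hexp) (by positivity)
    _ = n.factorial / (γ / 2) ^ n *
        ((u - 1) ^ s * (exp (-(γ * u)) * exp (γ / 2 * (u + 1)))) := by ring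
    _ = _ := by rw [← exp_add]; ring_nf

lemma integrableOn_exp_mul_sq_sub_one_rpow {s γ : ℝ} (hs : -1 < s) (hγ : 0 < γ) :
    IntegrableOn (fun u => exp (-(γ * u)) * (u ^ 2 - 1) ^ s) (Ioi 1) := by
  refine (integrableOn_mul_exp_mul_sq_sub_one_rpow hs hγ).mono'
    (measurable_exp_mul_sq_sub_one_rpow s γ).aestronglyMeasurable ?_
  refine (ae_restrict_iff' measurableSet_Ioi).2 (Eventually.of_forall fun u (hu : 1 < u) => ?_)
  have := sq_sub_one_pos hu
  rw [norm_of_nonneg (by positivity)]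
  exact le_mul_of_one_le_left (by positivity) hu.le

lemma besselIntegral_pos {s γ : ℝ} (hs : -1 < s) (hγ : 0 < γ) : 0 < besselIntegral s γ := by
  have hpos : ∀ u ∈ Ioi (1 : ℝ), 0 < exp (-(γ * u)) * (u ^ 2 - 1) ^ s := fun u hu => by
    have := sq_sub_one_pos hu
    positivity
  rw [besselIntegral, setIntegral_pos_iff_support_of_nonneg_ae
    ((ae_restrict_iff' measurableSet_Ioi).2 (Eventually.of_forall fun u hu => (hpos u hu).le))
    (integrableOn_exp_mul_sq_sub_one_rpow hs hγ)]
  rw [inter_eq_right.2 fun u hu => Function.mem_support.2 (hpos u hu).ne']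
  simp

/-- Differentiation of `besselIntegral` under the integral sign. -/
lemma hasDerivAt_besselIntegral_aux {s γ : ℝ} (hs : -1 < s) (hγ : 0 < γ) :
    HasDerivAt (besselIntegral s)
      (-∫ u in Ioi (1 : ℝ), u * (exp (-(γ * u)) * (u ^ 2 - 1) ^ s)) γ := by
  rw [← integral_neg]
  refine (hasDerivAt_integral_of_dominated_loc_of_deriv_le
    (F := fun x u => exp (-(x * u)) * (u ^ 2 - 1) ^ s)
    (F' := fun x u => -(u * (exp (-(x * u)) * (u ^ 2 - 1) ^ s)))
    (bound := fun u => u * (exp (-(γ / 2 * u)) * (u ^ 2 - 1) ^ s))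
    (Ioi_mem_nhds (half_lt_self hγ))
    (Eventually.of_forall fun x => (measurable_exp_mul_sq_sub_one_rpow s x).aestronglyMeasurable)
    (integrableOn_exp_mul_sq_sub_one_rpow hs hγ)
    (integrableOn_mul_exp_mul_sq_sub_one_rpow hs hγ).neg.aestronglyMeasurable ?_
    (integrableOn_mul_exp_mul_sq_sub_one_rpow hs (half_pos hγ)) ?_).2
  · refine (ae_restrict_iff' measurableSet_Ioi).2
      (Eventually.of_forall fun u (hu : 1 < u) x (hx : γ / 2 < x) => ?_)
    have := sq_sub_one_pos hu
    rw [norm_neg, norm_of_nonneg (by positivity)]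
    gcongr
  · refine Eventually.of_forall fun u x _ => ?_
    exact ((((hasDerivAt_id' x).mul_const u).fun_neg.exp).mul_const ((u ^ 2 - 1) ^ s)).congr_deriv
      (by ring)

lemma hasDerivAt_sq_sub_one_rpow (s : ℝ) {u : ℝ} (hu : 1 < u) :
    HasDerivAt (fun u : ℝ => (u ^ 2 - 1) ^ (s + 1)) (2 * (s + 1) * (u * (u ^ 2 - 1) ^ s)) u := by
  refine ((((hasDerivAt_id' u).fun_pow 2).sub_const 1).rpow_const (p := s + 1)
    (Or.inl (sq_sub_one_pos hu).ne')).congr_deriv ?_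
  rw [add_sub_cancel_right]
  push_cast
  ring

lemma hasDerivAt_exp_neg_mul (γ u : ℝ) :
    HasDerivAt (fun u : ℝ => exp (-(γ * u))) (-(γ * exp (-(γ * u)))) u :=
  ((hasDerivAt_id' u).const_mul γ).fun_neg.exp.congr_deriv (by ring)

/-- If `f` vanishes at `1` and `f`, `f'` are integrable on `(1, ∞)`, then the integral of its
derivative there is zero. -/
lemma integral_Ioi_deriv_eq_zero {f f' : ℝ → ℝ} (hf : Continuous f) (h1 : f 1 = 0)
    (hd : ∀ u ∈ Ioi (1 : ℝ), HasDerivAt f (f' u) u) (hi : IntegrableOn f (Ioi 1))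
    (hi' : IntegrableOn f' (Ioi 1)) : ∫ u in Ioi (1 : ℝ), f' u = 0 := by
  have h := integral_Ioi_of_hasDerivAt_of_tendsto hf.continuousWithinAt hd hi'
    (tendsto_zero_of_hasDerivAt_of_integrableOn_Ioi hd hi' hi)
  rw [h, h1, sub_zero]

lemma continuous_exp_mul_sq_sub_one_rpow {s : ℝ} (γ : ℝ) (hs : 0 ≤ s) :
    Continuous fun u : ℝ => exp (-(γ * u)) * (u ^ 2 - 1) ^ s :=
  (by fun_prop : Continuous fun u : ℝ => exp (-(γ * u))).mul
    ((by fun_prop : Continuous fun u : ℝ => u ^ 2 - 1).rpow_const fun _ => Or.inr hs)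

lemma integral_mul_exp_mul_sq_sub_one_rpow {s γ : ℝ} (hs : -1 < s) (hγ : 0 < γ) :
    2 * (s + 1) * ∫ u in Ioi (1 : ℝ), u * (exp (-(γ * u)) * (u ^ 2 - 1) ^ s) =
      γ * besselIntegral (s + 1) γ := by
  have hI := (integrableOn_mul_exp_mul_sq_sub_one_rpow hs hγ).const_mul (2 * (s + 1))
  have hJ := integrableOn_exp_mul_sq_sub_one_rpow (s := s + 1) (by linarith) hγ
  have h := integral_Ioi_deriv_eq_zero (continuous_exp_mul_sq_sub_one_rpow γ (by linarith))
    (f' := fun u => 2 * (s + 1) * (u * (exp (-(γ * u)) * (u ^ 2 - 1) ^ s)) -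
      γ * (exp (-(γ * u)) * (u ^ 2 - 1) ^ (s + 1)))
    (by simp [zero_rpow (by linarith : s + 1 ≠ 0)])
    (fun u hu => ((hasDerivAt_exp_neg_mul γ u).fun_mul
      (hasDerivAt_sq_sub_one_rpow s hu)).congr_deriv (by ring))
    hJ (hI.sub' (hJ.const_mul γ))
  rw [integral_sub hI (hJ.const_mul γ), integral_const_mul, integral_const_mul] at h
  exact sub_eq_zero.1 h

lemma mul_integral_mul_exp_mul_sq_sub_one_rpow {s γ : ℝ} (hs : -1 < s) (hγ : 0 < γ) :
    γ * ∫ u in Ioi (1 : ℝ), u * (exp (-(γ * u)) * (u ^ 2 - 1) ^ (s + 1)) =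
      (2 * s + 3) * besselIntegral (s + 1) γ + 2 * (s + 1) * besselIntegral s γ := by
  have hJ := integrableOn_exp_mul_sq_sub_one_rpow (s := s + 1) (by linarith) hγ
  have hJ' := integrableOn_exp_mul_sq_sub_one_rpow hs hγ
  have hI := integrableOn_mul_exp_mul_sq_sub_one_rpow (s := s + 1) (by linarith) hγ
  have hsum := (hJ.const_mul (2 * s + 3)).fun_add (hJ'.const_mul (2 * (s + 1)))
  have h := integral_Ioi_deriv_eq_zero
    (continuous_id'.mul (continuous_exp_mul_sq_sub_one_rpow γ (by linarith : 0 ≤ s + 1)))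
    (f' := fun u => ((2 * s + 3) * (exp (-(γ * u)) * (u ^ 2 - 1) ^ (s + 1)) +
      2 * (s + 1) * (exp (-(γ * u)) * (u ^ 2 - 1) ^ s)) -
      γ * (u * (exp (-(γ * u)) * (u ^ 2 - 1) ^ (s + 1))))
    (by simp [zero_rpow (by linarith : s + 1 ≠ 0)])
    (fun u hu => by
      refine ((hasDerivAt_id' u).fun_mul ((hasDerivAt_exp_neg_mul γ u).fun_mul
        (hasDerivAt_sq_sub_one_rpow s hu))).congr_deriv ?_
      simp only [rpow_add_one (sq_sub_one_pos hu).ne']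
      ring)
    hI (hsum.sub' (hI.const_mul γ))
  rw [integral_sub hsum (hI.const_mul γ),
    integral_add (hJ.const_mul (2 * s + 3)) (hJ'.const_mul (2 * (s + 1))),
    integral_const_mul, integral_const_mul, integral_const_mul] at h
  exact (sub_eq_zero.1 h).symm

lemma hasDerivAt_besselIntegral {s γ : ℝ} (hs : -1 < s) (hγ : 0 < γ) :
    HasDerivAt (besselIntegral s) (-(γ / (2 * s + 2) * besselIntegral (s + 1) γ)) γ := by
  convert hasDerivAt_besselIntegral_aux hs hγ using 2
  have h : 2 * s + 2 ≠ 0 := by linarith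
  rw [div_mul_eq_mul_div, div_eq_iff h, ← integral_mul_exp_mul_sq_sub_one_rpow hs hγ]
  ring

lemma hasDerivAt_besselIntegral_add_one {s γ : ℝ} (hs : -1 < s) (hγ : 0 < γ) :
    HasDerivAt (besselIntegral (s + 1))
      (-(((2 * s + 3) * besselIntegral (s + 1) γ + (2 * s + 2) * besselIntegral s γ) / γ)) γ := by
  convert hasDerivAt_besselIntegral_aux (s := s + 1) (by linarith) hγ using 2
  rw [div_eq_iff hγ.ne', mul_comm _ γ, mul_integral_mul_exp_mul_sq_sub_one_rpow hs hγ]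
  ring

lemma besselK_eq_besselIntegral (j : ℕ) {γ : ℝ} (hγ : 0 < γ) :
    besselK j γ = (2 : ℝ) ^ j * j.factorial / (2 * j).factorial * γ ^ j *
      besselIntegral ((j : ℝ) - 1 / 2) γ := by
  have h := integral_comp_mul_left_Ioi
    (fun l => exp (-l) * (l ^ 2 - γ ^ 2) ^ ((j : ℝ) - 1 / 2)) 1 hγ
  rw [mul_one, smul_eq_mul, eq_inv_mul_iff_mul_eq₀ hγ.ne'] at h
  have hscale : ∫ u in Ioi (1 : ℝ), exp (-(γ * u)) * ((γ * u) ^ 2 - γ ^ 2) ^ ((j : ℝ) - 1 / 2) =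
      γ ^ (2 * j) / γ * besselIntegral ((j : ℝ) - 1 / 2) γ := by
    rw [besselIntegral, ← integral_const_mul]
    refine setIntegral_congr_fun measurableSet_Ioi fun u hu => ?_
    have hu' := sq_sub_one_pos hu
    have hsplit : (γ * u) ^ 2 - γ ^ 2 = γ ^ 2 * (u ^ 2 - 1) := by ring
    have hrpow : (γ ^ 2) ^ ((j : ℝ) - 1 / 2) = γ ^ (2 * j) / γ := by
      rw [rpow_sub (by positivity), rpow_natCast, ← sqrt_eq_rpow, sqrt_sq hγ.le, pow_mul]
    simp only [hsplit, mul_rpow (sq_nonneg γ) hu'.le, hrpow]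
    ring
  rw [besselK, ← h, hscale, mul_comm 2 j, pow_mul, mul_comm j 2]
  field_simp

lemma hRatio_eq_besselIntegral (i : ℕ) {γ : ℝ} (hγ : 0 < γ) :
    hRatio i γ = (2 * (i : ℝ) + 1) * besselIntegral ((i : ℝ) - 1 / 2) γ /
      (γ * besselIntegral ((i : ℝ) - 1 / 2 + 1) γ) := by
  have hs : ((i + 1 : ℕ) : ℝ) - 1 / 2 = (i : ℝ) - 1 / 2 + 1 := by push_cast; ring
  have hi : (0 : ℝ) ≤ i := i.cast_nonneg
  have hB := (besselIntegral_pos (s := (i : ℝ) - 1 / 2 + 1) (by linarith) hγ).ne'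
  rw [hRatio, besselK_eq_besselIntegral i hγ, besselK_eq_besselIntegral (i + 1) hγ, hs,
    mul_add_one 2 i, Nat.factorial_succ (2 * i + 1), Nat.factorial_succ (2 * i),
    Nat.factorial_succ i]
  push_cast
  field_simp
  ring

/-- For `i ∈ {0,1}`, `h_i` is differentiable on `(0,∞)` with
`h_i'(γ) = h_i(γ)² + (2i+1) h_i(γ)/γ − 1`. -/
theorem hRatio_hasDerivAt (i : ℕ) (hi : i = 0 ∨ i = 1) (γ : ℝ) (hγ : 0 < γ) :
    HasDerivAt (hRatio i)
      (hRatio i γ ^ 2 + (2 * (i : ℝ) + 1) * hRatio i γ / γ - 1) γ := by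
  have hi0 : (0 : ℝ) ≤ i := i.cast_nonneg
  have hs : -1 < (i : ℝ) - 1 / 2 := by linarith
  have hB := (besselIntegral_pos (s := (i : ℝ) - 1 / 2 + 1) (by linarith) hγ).ne'
  have hA' := hasDerivAt_besselIntegral hs hγ
  have hB' := hasDerivAt_besselIntegral_add_one hs hγ
  have h := (hA'.const_mul (2 * (i : ℝ) + 1)).fun_div ((hasDerivAt_id' γ).fun_mul hB')
    (mul_ne_zero hγ.ne' hB)
  refine HasDerivAt.congr_of_eventuallyEq ?_ ((eventually_gt_nhds hγ).mono fun x hx =>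
    hRatio_eq_besselIntegral i hx)
  refine h.congr_deriv ?_
  rw [hRatio_eq_besselIntegral i hγ]
  have h2 : 2 * ((i : ℝ) - 1 / 2) + 2 = 2 * i + 1 := by ring
  have h3 : 2 * ((i : ℝ) - 1 / 2) + 3 = 2 * i + 2 := by ring
  rw [h2, h3]
  generalize besselIntegral ((i : ℝ) - 1 / 2 + 1) γ = B at hB ⊢
  generalize besselIntegral ((i : ℝ) - 1 / 2) γ = A
  field_simp
  ring
end

section
/- For each i ∈ {0,1} and every real γ > 0, one has g_i(γ) := γ²·(h_i(γ)² − 1) + (2i+1)·γ·h_i(γ) − 4 < 0. -/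
open MeasureTheory Real

/-- The density `e^{-λ} (λ - γ)^n (λ² - γ²)^{-1/2}` of the `n`-th shifted moment. -/
noncomputable def shiftedDensity (γ : ℝ) (n : ℕ) (l : ℝ) : ℝ :=
  exp (-l) * (l - γ) ^ n * (l ^ 2 - γ ^ 2) ^ (-(1 / 2) : ℝ)

/-- The `n`-th moment of `λ - γ` against the weight `e^{-λ} (λ² - γ²)^{-1/2}` on `(γ, ∞)`. -/
noncomputable def shiftedMoment (γ : ℝ) (n : ℕ) : ℝ :=
  ∫ l in Set.Ioi γ, shiftedDensity γ n l

lemma sq_sub_sq_pos_of_lt {γ l : ℝ} (hγ : 0 < γ) (hl : γ < l) : 0 < l ^ 2 - γ ^ 2 := by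
  nlinarith

lemma shiftedDensity_pos {γ l : ℝ} (hγ : 0 < γ) (hl : γ < l) (n : ℕ) :
    0 < shiftedDensity γ n l := by
  have h1 := sq_sub_sq_pos_of_lt hγ hl
  have h2 : 0 < l - γ := sub_pos.2 hl
  unfold shiftedDensity
  positivity

lemma integrableOn_shiftedDensity {γ : ℝ} (hγ : 0 < γ) (n : ℕ) :
    IntegrableOn (shiftedDensity γ n) (Set.Ioi γ) := by
  have hG := Real.GammaIntegral_convergent (s := (n : ℝ) + 1 / 2) (by positivity)
  have hS : IntegrableOn (fun l : ℝ => exp (-(l - γ)) * (l - γ) ^ ((n : ℝ) + 1 / 2 - 1))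
      (Set.Ioi γ) := by
    have h := ((measurePreserving_sub_right volume γ).integrableOn_comp_preimage
      (MeasurableEquiv.subRight γ).measurableEmbedding).2 hG
    rwa [Set.preimage_sub_const_Ioi, zero_add] at h
  refine Integrable.mono' (hS.const_mul ((2 * γ) ^ (-(1 / 2) : ℝ))) ?_ ?_
  · unfold shiftedDensity
    exact (by fun_prop : Measurable _).aestronglyMeasurable
  · refine (ae_restrict_iff' measurableSet_Ioi).2 (.of_forall fun l hl => ?_)
    have hl' : 0 < l - γ := sub_pos.2 hl
    rw [Real.norm_of_nonneg (shiftedDensity_pos hγ hl n).le]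
    have hfac : (l ^ 2 - γ ^ 2) ^ (-(1 / 2) : ℝ)
        = (l + γ) ^ (-(1 / 2) : ℝ) * (l - γ) ^ (-(1 / 2) : ℝ) := by
      rw [← mul_rpow (by linarith) hl'.le]
      ring_nf
    have hpow : (l - γ) ^ ((n : ℝ) + 1 / 2 - 1) = (l - γ) ^ n * (l - γ) ^ (-(1 / 2) : ℝ) := by
      rw [← rpow_natCast, ← rpow_add hl']
      ring_nf
    have hle : (l + γ) ^ (-(1 / 2) : ℝ) ≤ (2 * γ) ^ (-(1 / 2) : ℝ) :=
      rpow_le_rpow_of_nonpos (by linarith) (by linarith) (by norm_num)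
    have hexp : exp (-l) ≤ exp (-(l - γ)) := exp_le_exp.2 (by linarith)
    unfold shiftedDensity
    rw [hfac, hpow]
    calc exp (-l) * (l - γ) ^ n * ((l + γ) ^ (-(1 / 2) : ℝ) * (l - γ) ^ (-(1 / 2) : ℝ))
        = (l + γ) ^ (-(1 / 2) : ℝ) * (exp (-l) * ((l - γ) ^ n * (l - γ) ^ (-(1 / 2) : ℝ))) := by
          ring
      _ ≤ _ := by gcongr

lemma tendsto_exp_neg_mul_pow_mul_sqrt {γ : ℝ} (hγ : 0 < γ) (n : ℕ) :
    Filter.Tendsto (fun l : ℝ => exp (-l) * (l - γ) ^ n * (l ^ 2 - γ ^ 2) ^ (1 / 2 : ℝ))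
      Filter.atTop (nhds 0) := by
  refine squeeze_zero' ?_ ?_ (Real.tendsto_pow_mul_exp_neg_atTop_nhds_zero (n + 1))
  · filter_upwards [Filter.eventually_gt_atTop γ] with l hl
    have h1 := sq_sub_sq_pos_of_lt hγ hl
    have h2 : 0 < l - γ := sub_pos.2 hl
    positivity
  · filter_upwards [Filter.eventually_gt_atTop γ] with l hl
    have h2 : 0 < l - γ := sub_pos.2 hl
    have h3 : (l ^ 2 - γ ^ 2) ^ (1 / 2 : ℝ) ≤ l := by
      rw [← sqrt_eq_rpow]
      exact sqrt_le_iff.2 ⟨by linarith, by nlinarith⟩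
    have h4 : (l - γ) ^ n ≤ l ^ n := by gcongr; linarith
    have h1 := sq_sub_sq_pos_of_lt hγ hl
    have h5 : 0 ≤ l ^ n := pow_nonneg (by linarith) n
    calc exp (-l) * (l - γ) ^ n * (l ^ 2 - γ ^ 2) ^ (1 / 2 : ℝ)
        ≤ exp (-l) * l ^ n * l := by gcongr
      _ = l ^ (n + 1) * exp (-l) := by ring

lemma hasDerivAt_exp_neg_mul_pow_mul_sqrt {γ l : ℝ} (hγ : 0 < γ) (hl : γ < l) (n : ℕ) :
    HasDerivAt (fun l : ℝ => exp (-l) * (l - γ) ^ n * (l ^ 2 - γ ^ 2) ^ (1 / 2 : ℝ))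
      (((n : ℝ) + 1 - 2 * γ) * shiftedDensity γ (n + 1) l
        + (2 * n + 1) * γ * shiftedDensity γ n l - shiftedDensity γ (n + 2) l) l := by
  have hw := sq_sub_sq_pos_of_lt hγ hl
  have h1 : HasDerivAt (fun l : ℝ => exp (-l)) (exp (-l) * (-1)) l := (hasDerivAt_neg l).exp
  have h2 : HasDerivAt (fun l : ℝ => (l - γ) ^ n) (n * (l - γ) ^ (n - 1) * 1) l :=
    ((hasDerivAt_id l).sub_const γ).pow n
  have h3 : HasDerivAt (fun l : ℝ => l ^ 2 - γ ^ 2) (2 * l) l := by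
    simpa using (hasDerivAt_pow 2 l).sub_const (γ ^ 2)
  have h4 := h3.rpow_const (p := (1 / 2 : ℝ)) (Or.inl hw.ne')
  refine ((h1.mul h2).mul h4).congr_deriv ?_
  have hhalf : (l ^ 2 - γ ^ 2) ^ (1 / 2 : ℝ)
      = (l ^ 2 - γ ^ 2) * (l ^ 2 - γ ^ 2) ^ (-(1 / 2) : ℝ) := by
    rw [← rpow_one_add' hw.le (by norm_num)]
    norm_num
  have hneg : (1 / 2 - 1 : ℝ) = -(1 / 2) := by norm_num
  simp only [Pi.mul_apply, shiftedDensity]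
  rw [hhalf, hneg]
  rcases n with _ | n
  · simp only [Nat.cast_zero]
    ring
  · simp only [Nat.add_sub_cancel]
    push_cast
    ring

lemma shiftedMoment_add_two {γ : ℝ} (hγ : 0 < γ) (n : ℕ) :
    shiftedMoment γ (n + 2) = ((n : ℝ) + 1 - 2 * γ) * shiftedMoment γ (n + 1)
      + (2 * n + 1) * γ * shiftedMoment γ n := by
  have i0 := integrableOn_shiftedDensity hγ n
  have i1 := integrableOn_shiftedDensity hγ (n + 1)
  have i2 := integrableOn_shiftedDensity hγ (n + 2)
  have j1 := i1.const_mul ((n : ℝ) + 1 - 2 * γ)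
  have j0 := i0.const_mul ((2 * n + 1) * γ)
  have j10 : IntegrableOn (fun l => ((n : ℝ) + 1 - 2 * γ) * shiftedDensity γ (n + 1) l
      + (2 * n + 1) * γ * shiftedDensity γ n l) (Set.Ioi γ) := j1.add j0
  have key := integral_Ioi_of_hasDerivAt_of_tendsto (a := γ)
    (f := fun l : ℝ => exp (-l) * (l - γ) ^ n * (l ^ 2 - γ ^ 2) ^ (1 / 2 : ℝ))
    (Continuous.continuousWithinAt (by
      have : Continuous fun l : ℝ => (l ^ 2 - γ ^ 2) ^ (1 / 2 : ℝ) :=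
        Continuous.rpow_const (by fun_prop) fun _ => Or.inr (by norm_num)
      fun_prop))
    (fun l hl => hasDerivAt_exp_neg_mul_pow_mul_sqrt hγ hl n)
    (j10.sub i2) (tendsto_exp_neg_mul_pow_mul_sqrt hγ n)
  have hsplit : ∫ l in Set.Ioi γ, (((n : ℝ) + 1 - 2 * γ) * shiftedDensity γ (n + 1) l
        + (2 * n + 1) * γ * shiftedDensity γ n l - shiftedDensity γ (n + 2) l)
      = ((n : ℝ) + 1 - 2 * γ) * shiftedMoment γ (n + 1)
        + (2 * n + 1) * γ * shiftedMoment γ n - shiftedMoment γ (n + 2) := by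
    rw [integral_sub j10 i2, integral_add j1 j0, integral_const_mul, integral_const_mul]
    rfl
  rw [hsplit] at key
  have hz : (γ ^ 2 - γ ^ 2 : ℝ) ^ (1 / 2 : ℝ) = 0 := by
    rw [sub_self, zero_rpow (by norm_num)]
  simp only [hz, mul_zero, sub_zero] at key
  linarith

lemma shiftedMoment_pos {γ : ℝ} (hγ : 0 < γ) (n : ℕ) : 0 < shiftedMoment γ n := by
  refine (setIntegral_pos_iff_support_of_nonneg_ae ?_ (integrableOn_shiftedDensity hγ n)).2 ?_
  · exact (ae_restrict_iff' measurableSet_Ioi).2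
      (.of_forall fun l hl => (shiftedDensity_pos hγ hl n).le)
  · have hsub : Set.Ioi γ ⊆ Function.support (shiftedDensity γ n) :=
      fun l hl => (shiftedDensity_pos hγ hl n).ne'
    rw [Set.inter_eq_right.2 hsub]
    simp

/-- Nonnegativity of the integral of `(λ - γ)^n (λ - γ - c)²`. -/
lemma shiftedMoment_quadratic_nonneg {γ : ℝ} (hγ : 0 < γ) (n : ℕ) (c : ℝ) :
    0 ≤ shiftedMoment γ (n + 2) - 2 * c * shiftedMoment γ (n + 1) + c ^ 2 * shiftedMoment γ n := by
  have i0 := (integrableOn_shiftedDensity hγ n).const_mul (c ^ 2)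
  have i1 := (integrableOn_shiftedDensity hγ (n + 1)).const_mul (2 * c)
  have i2 := integrableOn_shiftedDensity hγ (n + 2)
  have i21 : IntegrableOn (fun l => shiftedDensity γ (n + 2) l
      - 2 * c * shiftedDensity γ (n + 1) l) (Set.Ioi γ) := i2.sub i1
  have hsplit : ∫ l in Set.Ioi γ, (shiftedDensity γ (n + 2) l
        - 2 * c * shiftedDensity γ (n + 1) l + c ^ 2 * shiftedDensity γ n l)
      = shiftedMoment γ (n + 2) - 2 * c * shiftedMoment γ (n + 1)
        + c ^ 2 * shiftedMoment γ n := by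
    rw [integral_add i21 i0, integral_sub i2 i1, integral_const_mul, integral_const_mul]
    rfl
  rw [← hsplit]
  refine setIntegral_nonneg measurableSet_Ioi fun l hl => ?_
  have h : shiftedDensity γ (n + 2) l - 2 * c * shiftedDensity γ (n + 1) l
      + c ^ 2 * shiftedDensity γ n l = shiftedDensity γ n l * (l - γ - c) ^ 2 := by
    unfold shiftedDensity
    ring
  rw [h]
  exact mul_nonneg (shiftedDensity_pos hγ hl n).le (sq_nonneg _)

lemma besselK_zero_eq (γ : ℝ) : besselK 0 γ = shiftedMoment γ 0 := by
  simp [besselK, shiftedMoment, shiftedDensity]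

lemma besselK_one_eq {γ : ℝ} (hγ : 0 < γ) :
    besselK 1 γ = (shiftedMoment γ 1 + γ * shiftedMoment γ 0) / γ := by
  have i1 := (integrableOn_shiftedDensity hγ 1).const_mul (2 * γ)
  have i2 := integrableOn_shiftedDensity hγ 2
  have hint : ∫ l in Set.Ioi γ, exp (-l) * (l ^ 2 - γ ^ 2) ^ (((1 : ℕ) : ℝ) - 1 / 2)
      = shiftedMoment γ 2 + 2 * γ * shiftedMoment γ 1 := by
    unfold shiftedMoment
    rw [← integral_const_mul, ← integral_add i2 i1]
    refine setIntegral_congr_fun measurableSet_Ioi fun l hl => ?_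
    have hw := sq_sub_sq_pos_of_lt hγ hl
    have hp : (l ^ 2 - γ ^ 2) ^ (((1 : ℕ) : ℝ) - 1 / 2)
        = (l ^ 2 - γ ^ 2) ^ 1 * (l ^ 2 - γ ^ 2) ^ (-(1 / 2) : ℝ) := by
      rw [← rpow_natCast (l ^ 2 - γ ^ 2) 1, ← rpow_add hw, ← sub_eq_add_neg]
    simp only [shiftedDensity, hp]
    ring
  have hrec := shiftedMoment_add_two hγ 0
  norm_num at hrec
  rw [besselK, hint, hrec]
  norm_num [Nat.factorial]
  field_simp
  ring

lemma besselK_two_eq {γ : ℝ} (hγ : 0 < γ) :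
    besselK 2 γ = (γ ^ 2 * shiftedMoment γ 0
      + 2 * (shiftedMoment γ 1 + γ * shiftedMoment γ 0)) / γ ^ 2 := by
  have i2 := (integrableOn_shiftedDensity hγ 2).const_mul (4 * γ ^ 2)
  have i3 := (integrableOn_shiftedDensity hγ 3).const_mul (4 * γ)
  have i4 := integrableOn_shiftedDensity hγ 4
  have i43 : IntegrableOn (fun l => shiftedDensity γ 4 l + 4 * γ * shiftedDensity γ 3 l)
      (Set.Ioi γ) := i4.add i3
  have hint : ∫ l in Set.Ioi γ, exp (-l) * (l ^ 2 - γ ^ 2) ^ (((2 : ℕ) : ℝ) - 1 / 2)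
      = shiftedMoment γ 4 + 4 * γ * shiftedMoment γ 3 + 4 * γ ^ 2 * shiftedMoment γ 2 := by
    unfold shiftedMoment
    rw [← integral_const_mul, ← integral_const_mul, ← integral_add i4 i3,
      ← integral_add i43 i2]
    refine setIntegral_congr_fun measurableSet_Ioi fun l hl => ?_
    have hw := sq_sub_sq_pos_of_lt hγ hl
    have hp : (l ^ 2 - γ ^ 2) ^ (((2 : ℕ) : ℝ) - 1 / 2)
        = (l ^ 2 - γ ^ 2) ^ 2 * (l ^ 2 - γ ^ 2) ^ (-(1 / 2) : ℝ) := by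
      rw [← rpow_natCast (l ^ 2 - γ ^ 2) 2, ← rpow_add hw, ← sub_eq_add_neg]
    simp only [shiftedDensity, hp]
    ring
  have h2 := shiftedMoment_add_two hγ 0
  have h3 := shiftedMoment_add_two hγ 1
  have h4 := shiftedMoment_add_two hγ 2
  norm_num at h2 h3 h4
  rw [besselK, hint, h4, h3, h2]
  norm_num [Nat.factorial]
  field_simp
  ring

/-- Cauchy–Schwarz gives a lower bound on `x = γ K₀(γ) / K₁(γ)`. -/
lemma sq_le_of_hRatio_zero {γ : ℝ} (hγ : 0 < γ) :
    γ ^ 2 ≤ (γ * hRatio 0 γ) ^ 2 + γ * hRatio 0 γ := by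
  have ha := shiftedMoment_pos hγ 0
  have hb := shiftedMoment_pos hγ 1
  have h2 := shiftedMoment_add_two hγ 0
  have hq := shiftedMoment_quadratic_nonneg hγ 0 (shiftedMoment γ 1 / shiftedMoment γ 0)
  norm_num at h2 hq
  rw [h2] at hq
  rw [hRatio, besselK_zero_eq, besselK_one_eq hγ]
  set a := shiftedMoment γ 0
  set b := shiftedMoment γ 1
  have hq' : 0 ≤ a * ((1 - 2 * γ) * b + γ * a) - b ^ 2 := by
    have := mul_nonneg ha.le hq
    field_simp at this
    linarith
  have hJ : 0 < b + γ * a := by positivity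
  have hx : (γ * (a / ((b + γ * a) / γ))) ^ 2 + γ * (a / ((b + γ * a) / γ)) - γ ^ 2
      = γ ^ 2 * (a * ((1 - 2 * γ) * b + γ * a) - b ^ 2) / (b + γ * a) ^ 2 := by
    field_simp
    ring
  have : 0 ≤ γ ^ 2 * (a * ((1 - 2 * γ) * b + γ * a) - b ^ 2) / (b + γ * a) ^ 2 := by positivity
  linarith

lemma hRatio_zero_pos {γ : ℝ} (hγ : 0 < γ) : 0 < hRatio 0 γ := by
  have ha := shiftedMoment_pos hγ 0
  have hb := shiftedMoment_pos hγ 1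
  rw [hRatio, besselK_zero_eq, besselK_one_eq hγ]
  positivity

/-- An upper bound on `x = γ K₀(γ) / K₁(γ)`, in terms of the defect `γ - x`. -/
lemma two_mul_sq_le_of_hRatio_zero {γ : ℝ} (hγ : 0 < γ) :
    2 * γ ^ 2 ≤ (γ - γ * hRatio 0 γ) * (4 * γ ^ 2 + 3 * γ + 1) := by
  have ha := shiftedMoment_pos hγ 0
  have hb := shiftedMoment_pos hγ 1
  have h2 := shiftedMoment_add_two hγ 0
  have h3 := shiftedMoment_add_two hγ 1
  have hq := shiftedMoment_quadratic_nonneg hγ 1 1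
  norm_num at h2 h3 hq
  rw [h3, h2] at hq
  rw [hRatio, besselK_zero_eq, besselK_one_eq hγ]
  set a := shiftedMoment γ 0
  set b := shiftedMoment γ 1
  have hq' : 0 ≤ b * (4 * γ ^ 2 + γ + 1) - 2 * γ ^ 2 * a := by linarith
  have hJ : 0 < b + γ * a := by positivity
  have hx : (γ - γ * (a / ((b + γ * a) / γ))) * (4 * γ ^ 2 + 3 * γ + 1) - 2 * γ ^ 2
      = γ * (b * (4 * γ ^ 2 + γ + 1) - 2 * γ ^ 2 * a) / (b + γ * a) := by
    field_simp
    ring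
  have : 0 ≤ γ * (b * (4 * γ ^ 2 + γ + 1) - 2 * γ ^ 2 * a) / (b + γ * a) := by positivity
  linarith

/-- The recurrence `K₂ = K₀ + (2/γ) K₁` in terms of ratios. -/
lemma hRatio_one_eq {γ : ℝ} (hγ : 0 < γ) : hRatio 1 γ = γ / (γ * hRatio 0 γ + 2) := by
  have ha := shiftedMoment_pos hγ 0
  have hb := shiftedMoment_pos hγ 1
  rw [hRatio, hRatio, besselK_zero_eq, besselK_one_eq hγ, besselK_two_eq hγ]
  field_simp

/-- For `i ∈ {0,1}` and `γ > 0`, `g_i(γ) = γ²(h_i² − 1) + (2i+1) γ h_i − 4 < 0`. -/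
theorem g_neg (i : ℕ) (hi : i = 0 ∨ i = 1) (γ : ℝ) (hγ : 0 < γ) :
    γ ^ 2 * (hRatio i γ ^ 2 - 1) + (2 * (i : ℝ) + 1) * γ * hRatio i γ - 4 < 0 := by
  have hx : 0 < γ * hRatio 0 γ := mul_pos hγ (hRatio_zero_pos hγ)
  rcases hi with rfl | rfl
  · have hB := two_mul_sq_le_of_hRatio_zero hγ
    push_cast
    obtain ⟨d, hd⟩ : ∃ d, d = γ - γ * hRatio 0 γ := ⟨_, rfl⟩
    rw [← hd] at hB
    have hdγ : d < γ := by linarith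
    have hd0 : 0 < d := by
      by_contra! h
      nlinarith [mul_nonneg (neg_nonneg.2 h) (by positivity : 0 ≤ 4 * γ ^ 2 + 3 * γ + 1)]
    have hgoal : γ ^ 2 * (hRatio 0 γ ^ 2 - 1) + (2 * 0 + 1) * γ * hRatio 0 γ - 4
        = d ^ 2 - 2 * γ * d + γ - d - 4 := by
      rw [hd]
      ring
    rw [hgoal]
    rcases le_total 1 d with h1 | h1
    · nlinarith
    · have : γ * (2 * γ) ≤ γ * (4 * γ * d + 3 * d + 1) := by nlinarith
      have := le_of_mul_le_mul_left this hγ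
      nlinarith
  · have hA := sq_le_of_hRatio_zero hγ
    rw [hRatio_one_eq hγ]
    set x := γ * hRatio 0 γ
    have hgoal : γ ^ 2 * ((γ / (x + 2)) ^ 2 - 1) + (2 * ((1 : ℕ) : ℝ) + 1) * γ * (γ / (x + 2)) - 4
        = -((γ ^ 2 + 4) * (x + 2) ^ 2 - γ ^ 4 - 3 * γ ^ 2 * (x + 2)) / (x + 2) ^ 2 := by
      push_cast
      field_simp
      ring
    rw [hgoal]
    refine div_neg_of_neg_of_pos (neg_neg_of_pos ?_) (by positivity)
    nlinarith [mul_nonneg (by positivity : 0 ≤ γ ^ 2 + 4) (sub_nonneg.2 hA), sq_pos_of_pos hγ]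
end

section
/- For each i ∈ {0,1} and every real γ > 0, one has σ_i(γ) := (γ·h_i(γ) + 4)/g_i(γ) + γ·h_i(γ) + 1 > 0, where g_i(γ) = γ²·(h_i(γ)² − 1) + (2i+1)·γ·h_i(γ) − 4. (Equivalently, the derivative e_p of the Synge energy with respect to pressure at constant entropy equals 3 + σ_i(γ) and is strictly greater than 3.) -/
open MeasureTheory Real

open Polynomial in
/-- Polynomials are integrable on `(γ, ∞)` against `e^{-l} (l² - γ²)^{-1/2} dl`. -/
lemma integrableOn_exp_neg_mul_eval {γ : ℝ} (hγ : 0 < γ) (P : ℝ[X]) :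
    IntegrableOn (fun l => exp (-l) * (l ^ 2 - γ ^ 2) ^ (-(1 / 2) : ℝ) * P.eval l)
      (Set.Ioi γ) := by
  have monomial_case : ∀ k : ℕ, IntegrableOn
      (fun l => exp (-l) * (l ^ 2 - γ ^ 2) ^ (-(1 / 2) : ℝ) * (l - γ) ^ k) (Set.Ioi γ) := by
    intro k
    have hGamma := Real.GammaIntegral_convergent (s := (k : ℝ) + 1 / 2) (by positivity)
    have hshift : IntegrableOn
        (fun l => exp (-(l - γ)) * (l - γ) ^ ((k : ℝ) + 1 / 2 - 1)) (Set.Ioi γ) := by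
      have := (measurePreserving_sub_right volume γ).integrableOn_comp_preimage
        (Homeomorph.subRight γ).measurableEmbedding
        (f := fun x => exp (-x) * x ^ ((k : ℝ) + 1 / 2 - 1)) (s := Set.Ioi 0)
      simpa [Function.comp_def] using this.2 hGamma
    refine (hshift.const_mul ((2 * γ) ^ (-(1 / 2) : ℝ))).mono' ?_ ?_
    · exact Measurable.aestronglyMeasurable (by fun_prop)
    · refine (ae_restrict_iff' measurableSet_Ioi).2 (.of_forall fun l hl => ?_)
      have hl' : 0 < l - γ := sub_pos.2 hl
      have hsq : l ^ 2 - γ ^ 2 = (l + γ) * (l - γ) := by ring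
      have hlγ : 0 < l + γ := by linarith
      rw [Real.norm_of_nonneg (by rw [hsq]; positivity), hsq,
        Real.mul_rpow hlγ.le hl'.le]
      have hpow : (l - γ) ^ ((k : ℝ) + 1 / 2 - 1)
          = (l - γ) ^ (-(1 / 2) : ℝ) * (l - γ) ^ k := by
        rw [← Real.rpow_natCast, ← Real.rpow_add hl']
        ring_nf
      have hbound : (l + γ) ^ (-(1 / 2) : ℝ) ≤ (2 * γ) ^ (-(1 / 2) : ℝ) :=
        Real.rpow_le_rpow_of_nonpos (by positivity) (by linarith) (by norm_num)
      have hexp : exp (-l) ≤ exp (-(l - γ)) := Real.exp_le_exp.2 (by linarith)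
      rw [hpow]
      calc exp (-l) * ((l + γ) ^ (-(1 / 2) : ℝ) * (l - γ) ^ (-(1 / 2) : ℝ)) * (l - γ) ^ k
          ≤ exp (-(l - γ)) * ((2 * γ) ^ (-(1 / 2) : ℝ) * (l - γ) ^ (-(1 / 2) : ℝ))
            * (l - γ) ^ k := by gcongr
        _ = _ := by ring
  have shifted_case : ∀ Q : ℝ[X], IntegrableOn
      (fun l => exp (-l) * (l ^ 2 - γ ^ 2) ^ (-(1 / 2) : ℝ) * Q.eval (l - γ))
      (Set.Ioi γ) := by
    intro Q
    induction Q using Polynomial.induction_on' with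
    | add p q hp hq =>
      simp only [eval_add, mul_add]
      exact Integrable.add hp hq
    | monomial n a =>
      refine IntegrableOn.congr_fun ((monomial_case n).const_mul a) (fun l _ => ?_)
        measurableSet_Ioi
      simp only [eval_monomial]
      ring
  refine IntegrableOn.congr_fun (shifted_case (P.comp (X + C γ))) (fun l _ => ?_)
    measurableSet_Ioi
  have heval : (X + C γ).eval (l - γ) = l := by rw [eval_add, eval_X, eval_C, sub_add_cancel]
  simp only [eval_comp, heval]

open Polynomial in
/-- Integration of polynomials over `(γ, ∞)` against `e^{-l} (l² - γ²)^{-1/2} dl`. -/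
noncomputable def weightedIntegral {γ : ℝ} (hγ : 0 < γ) : ℝ[X] →ₗ[ℝ] ℝ where
  toFun P := ∫ l in Set.Ioi γ, exp (-l) * (l ^ 2 - γ ^ 2) ^ (-(1 / 2) : ℝ) * P.eval l
  map_add' P Q := by
    simp only [eval_add, mul_add]
    exact integral_add (integrableOn_exp_neg_mul_eval hγ P) (integrableOn_exp_neg_mul_eval hγ Q)
  map_smul' a P := by
    rw [RingHom.id_apply, smul_eq_mul, ← integral_const_mul]
    congr 1
    ext l
    simp only [eval_smul, smul_eq_mul]
    ring

section

open Polynomial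

variable {γ : ℝ} (hγ : 0 < γ)

lemma weightedIntegral_nonneg {P : ℝ[X]} (hP : ∀ l, γ < l → 0 ≤ P.eval l) :
    0 ≤ weightedIntegral hγ P := by
  refine setIntegral_nonneg measurableSet_Ioi fun l hl => ?_
  have hl' : γ < l := hl
  have : 0 < l ^ 2 - γ ^ 2 := by nlinarith
  have := hP l hl
  positivity

lemma weightedIntegral_pos {P : ℝ[X]} (hP : ∀ l, γ < l → 0 < P.eval l) :
    0 < weightedIntegral hγ P := by
  have hpos : ∀ l ∈ Set.Ioi γ,
      0 < exp (-l) * (l ^ 2 - γ ^ 2) ^ (-(1 / 2) : ℝ) * P.eval l := fun l hl => by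
    have hl' : γ < l := hl
    have : 0 < l ^ 2 - γ ^ 2 := by nlinarith
    have := hP l hl
    positivity
  refine (setIntegral_pos_iff_support_of_nonneg_ae ?_
    (integrableOn_exp_neg_mul_eval hγ P)).2 ?_
  · exact (ae_restrict_iff' measurableSet_Ioi).2 (.of_forall fun l hl => (hpos l hl).le)
  · rw [Set.inter_eq_right.2 fun l hl => Function.mem_support.2 (hpos l hl).ne']
    simp

lemma setIntegral_rpow_eq_weightedIntegral (j : ℕ) :
    ∫ l in Set.Ioi γ, exp (-l) * (l ^ 2 - γ ^ 2) ^ ((j : ℝ) - 1 / 2)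
      = weightedIntegral hγ ((X ^ 2 - C (γ ^ 2)) ^ j) := by
  refine setIntegral_congr_fun measurableSet_Ioi fun l hl => ?_
  have hl' : γ < l := hl
  have hpos : 0 < l ^ 2 - γ ^ 2 := by nlinarith
  have hsplit : (l ^ 2 - γ ^ 2) ^ ((j : ℝ) - 1 / 2)
      = (l ^ 2 - γ ^ 2) ^ (-(1 / 2) : ℝ) * (l ^ 2 - γ ^ 2) ^ j := by
    rw [← Real.rpow_natCast (l ^ 2 - γ ^ 2), ← Real.rpow_add hpos]
    ring_nf
  simp only [hsplit, eval_sub, eval_pow, eval_X, eval_C, mul_assoc]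

/-- Integration by parts: the derivative of `e^{-l} P(l) (l² - γ²)^{1/2}` has integral zero. -/
lemma weightedIntegral_by_parts (P : ℝ[X]) :
    weightedIntegral hγ ((derivative P - P) * (X ^ 2 - C (γ ^ 2)) + P * X) = 0 := by
  have hderiv : ∀ l ∈ Set.Ioi γ,
      HasDerivAt (fun l => exp (-l) * P.eval l * (l ^ 2 - γ ^ 2) ^ (1 / 2 : ℝ))
        (exp (-l) * (l ^ 2 - γ ^ 2) ^ (-(1 / 2) : ℝ)
          * ((derivative P - P) * (X ^ 2 - C (γ ^ 2)) + P * X).eval l) l := by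
    intro l hl
    have hl' : γ < l := hl
    have hpos : 0 < l ^ 2 - γ ^ 2 := by nlinarith
    have hroot : (l ^ 2 - γ ^ 2) ^ (1 / 2 : ℝ)
        = (l ^ 2 - γ ^ 2) ^ (-(1 / 2) : ℝ) * (l ^ 2 - γ ^ 2) := by
      rw [← Real.rpow_add_one hpos.ne']
      norm_num
    have hexp : HasDerivAt (fun l : ℝ => exp (-l)) (-exp (-l)) l := by
      simpa using (hasDerivAt_neg l).exp
    have hquad : HasDerivAt (fun l : ℝ => l ^ 2 - γ ^ 2) (2 * l) l := by
      simpa using (hasDerivAt_pow 2 l).sub_const (γ ^ 2)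
    have hrpow := hquad.rpow_const (p := (1 / 2 : ℝ)) (Or.inl hpos.ne')
    rw [show (1 / 2 : ℝ) - 1 = -(1 / 2) by norm_num] at hrpow
    refine ((hexp.mul (P.hasDerivAt l)).mul hrpow).congr_deriv ?_
    simp only [Pi.mul_apply, hroot, eval_add, eval_sub, eval_mul, eval_pow, eval_X, eval_C]
    ring
  have hint := integrableOn_exp_neg_mul_eval hγ
    ((derivative P - P) * (X ^ 2 - C (γ ^ 2)) + P * X)
  have hcont : Continuous fun l => exp (-l) * P.eval l * (l ^ 2 - γ ^ 2) ^ (1 / 2 : ℝ) := by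
    refine (Continuous.mul (by fun_prop) P.continuous).mul ?_
    exact Continuous.rpow_const (by fun_prop) fun _ => Or.inr (by norm_num)
  have hself : IntegrableOn
      (fun l => exp (-l) * P.eval l * (l ^ 2 - γ ^ 2) ^ (1 / 2 : ℝ)) (Set.Ioi γ) := by
    refine (integrableOn_exp_neg_mul_eval hγ (P * (X ^ 2 - C (γ ^ 2)))).congr_fun
      (fun l hl => ?_) measurableSet_Ioi
    have hl' : γ < l := hl
    have hpos : 0 < l ^ 2 - γ ^ 2 := by nlinarith
    have hroot : (l ^ 2 - γ ^ 2) ^ (1 / 2 : ℝ)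
        = (l ^ 2 - γ ^ 2) ^ (-(1 / 2) : ℝ) * (l ^ 2 - γ ^ 2) := by
      rw [← Real.rpow_add_one hpos.ne']
      norm_num
    simp only [hroot, eval_sub, eval_mul, eval_pow, eval_X, eval_C]
    ring
  have hlim := tendsto_zero_of_hasDerivAt_of_integrableOn_Ioi hderiv hint hself
  have := integral_Ioi_of_hasDerivAt_of_tendsto hcont.continuousWithinAt hderiv hint hlim
  simpa [weightedIntegral] using this

end

open Polynomial in
/-- With `a = ∫ e^{-l} (l² - γ²)^{-1/2}` and `b = ∫ e^{-l} (l² - γ²)^{1/2}`, both positive, the first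
three Bessel functions are combinations of `a` and `b`, and two Hankel determinants of the
weight are nonnegative. -/
lemma exists_besselK_eq {γ : ℝ} (hγ : 0 < γ) : ∃ a b : ℝ, 0 < a ∧ 0 < b ∧
    besselK 0 γ = a ∧ besselK 1 γ = b / γ ∧ besselK 2 γ = a + 2 * b / γ ^ 2 ∧
    b ^ 2 ≤ a * (b + γ ^ 2 * a) ∧
    γ ^ 2 * a ^ 2 + 2 * a * b ≤ b ^ 2 + b ^ 2 / γ := by
  set L := weightedIntegral hγ with hL
  have hM1 : L X = L (X ^ 2 - C (γ ^ 2)) := by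
    have := weightedIntegral_by_parts hγ 1
    rw [← sub_eq_zero, ← map_sub, ← this]
    congr 1
    simp
    ring
  have hM2 : L (X ^ 2) = L X + γ ^ 2 * L 1 := by
    rw [hM1, ← smul_eq_mul, ← map_smul, ← map_add]
    congr 1
    simp [smul_eq_C_mul]
  have hM3 : L (X ^ 3) = γ ^ 2 * L X + 2 * L X + γ ^ 2 * L 1 := by
    have h := weightedIntegral_by_parts hγ X
    have hp : ((derivative X - X) * (X ^ 2 - C (γ ^ 2)) + X * X : ℝ[X])
        = (2 : ℝ) • X ^ 2 - (γ ^ 2) • 1 - X ^ 3 + (γ ^ 2) • X := by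
      simp [smul_eq_C_mul, -map_pow, map_ofNat C]
      ring
    rw [hp, ← hL] at h
    simp only [map_add, map_sub, map_smul, smul_eq_mul] at h
    linarith
  have hI2 : L ((X ^ 2 - C (γ ^ 2)) ^ 2) = 3 * (L (X ^ 3) - γ ^ 2 * L X) := by
    have h := weightedIntegral_by_parts hγ (X ^ 2 - C (γ ^ 2))
    have hp : ((derivative (X ^ 2 - C (γ ^ 2)) - (X ^ 2 - C (γ ^ 2))) * (X ^ 2 - C (γ ^ 2))
          + (X ^ 2 - C (γ ^ 2)) * X : ℝ[X])
        = (3 : ℝ) • X ^ 3 - (3 * γ ^ 2) • X - (X ^ 2 - C (γ ^ 2)) ^ 2 := by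
      simp [smul_eq_C_mul, -map_pow, map_ofNat C]
      ring
    rw [hp, ← hL] at h
    simp only [map_sub, map_smul, smul_eq_mul] at h
    linarith
  have ha : 0 < L 1 := weightedIntegral_pos hγ (by simp)
  have hb : 0 < L X := weightedIntegral_pos hγ fun l hl => by simpa using hγ.trans hl
  refine ⟨L 1, L X, ha, hb, ?_, ?_, ?_, ?_, ?_⟩
  · rw [besselK, setIntegral_rpow_eq_weightedIntegral hγ]
    simp [hL]
  · rw [besselK, setIntegral_rpow_eq_weightedIntegral hγ, hM1]
    simp [hL, Nat.factorial]
    ring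
  · rw [besselK, setIntegral_rpow_eq_weightedIntegral hγ, ← hL, hI2, hM3]
    simp [Nat.factorial]
    field_simp
    ring
  · have hquad : ∀ t : ℝ, 0 ≤ L 1 * (t * t) + (-2 * L X) * t + L (X ^ 2) := fun t => by
      have h := weightedIntegral_nonneg hγ (P := (X - C t) ^ 2) fun l _ => by
        simpa using sq_nonneg (l - t)
      have hp : ((X - C t) ^ 2 : ℝ[X]) = (t * t) • 1 + (-2 * t) • X + X ^ 2 := by
        simp [smul_eq_C_mul, map_ofNat C]
        ring
      rw [hp, ← hL] at h
      simp only [map_add, map_smul, smul_eq_mul] at h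
      linarith
    have := discrim_le_zero hquad
    rw [discrim, hM2] at this
    linarith
  · have hquad : ∀ t : ℝ, 0 ≤ (L X - γ * L 1) * (t * t) + (-2 * (L (X ^ 2) - γ * L X)) * t
        + (L (X ^ 3) - γ * L (X ^ 2)) := fun t => by
      have h := weightedIntegral_nonneg hγ (P := (X - C γ) * (X - C t) ^ 2) fun l hl => by
        simpa using mul_nonneg (sub_pos.2 hl).le (sq_nonneg (l - t))
      have hp : ((X - C γ) * (X - C t) ^ 2 : ℝ[X]) = (t * t) • X - (γ * (t * t)) • 1
          - (2 * t) • X ^ 2 + (2 * t * γ) • X + X ^ 3 - γ • X ^ 2 := by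
        simp [smul_eq_C_mul, map_ofNat C]
        ring
      rw [hp, ← hL] at h
      simp only [map_add, map_sub, map_smul, smul_eq_mul] at h
      linarith
    have := discrim_le_zero hquad
    rw [discrim, hM2, hM3] at this
    have hsum : L X ^ 2 + L X ^ 2 / γ = L X ^ 2 * (γ + 1) / γ := by field_simp
    rw [hsum, le_div_iff₀ hγ]
    linarith

/-- For `x > 0` the positivity of `σ` follows from a cubic inequality in `x = γ h`. -/
lemma sigma_pos_of_cubic {x r c : ℝ} (hx : 0 < x)
    (h : 0 < (x + 1) * (r - x ^ 2 - c * x) + 3 * x) :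
    (x + 4) / (x ^ 2 - r + c * x - 4) + x + 1 > 0 := by
  have hg : x ^ 2 - r + c * x - 4 < 0 := by
    by_contra! hg
    nlinarith
  have : (x + 4) / (x ^ 2 - r + c * x - 4) > -(x + 1) := by
    rw [gt_iff_lt, lt_div_iff_of_neg hg]
    linarith
  linarith

/-- For `i ∈ {0,1}` and `γ > 0`,
`σ_i(γ) = (γ h_i + 4)/g_i(γ) + γ h_i + 1 > 0`, where
`g_i(γ) = γ²(h_i² − 1) + (2i+1) γ h_i − 4`. Equivalently `e_p = 3 + σ_i(γ) > 3`. -/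
theorem sigma_pos (i : ℕ) (hi : i = 0 ∨ i = 1) (γ : ℝ) (hγ : 0 < γ) :
    (γ * hRatio i γ + 4) /
        (γ ^ 2 * (hRatio i γ ^ 2 - 1) + (2 * (i : ℝ) + 1) * γ * hRatio i γ - 4)
      + γ * hRatio i γ + 1 > 0 := by
  obtain ⟨a, b, ha, hb, h0, h1, h2, hlow, hupp⟩ := exists_besselK_eq hγ
  obtain ⟨y, hy⟩ : ∃ y, y = γ ^ 2 * a / b := ⟨_, rfl⟩
  have hy0 : 0 < y := by rw [hy]; positivity
  have hya : a = y * b / γ ^ 2 := by rw [hy]; field_simp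
  have hlow' : γ ^ 2 ≤ y ^ 2 + y := by
    rw [hya] at hlow
    field_simp at hlow
    linarith
  have hupp' : y ^ 2 + 2 * y ≤ γ ^ 2 + γ := by
    rw [hya] at hupp
    field_simp at hupp
    linarith
  suffices h : 0 < γ * hRatio i γ ∧ 0 < (γ * hRatio i γ + 1) *
      (γ ^ 2 - (γ * hRatio i γ) ^ 2 - (2 * (i : ℝ) + 1) * (γ * hRatio i γ))
        + 3 * (γ * hRatio i γ) by
    convert sigma_pos_of_cubic h.1 h.2 using 4
    ring
  rcases hi with rfl | rfl
  · have hx : γ * hRatio 0 γ = y := by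
      rw [hRatio, h0, h1, hy]
      field_simp
    rw [hx]
    refine ⟨hy0, ?_⟩
    by_contra! hcub
    norm_num at hcub
    have hγy : y * (y + 4) ≤ γ * (y + 1) := by nlinarith
    have hsq : (y * (y + 4)) ^ 2 ≤ (γ * (y + 1)) ^ 2 := by gcongr
    have hcub' := mul_le_mul_of_nonneg_right hcub (by positivity : 0 ≤ y + 1)
    have : 0 < y * (5 * y ^ 2 + 16 * y + 2) := by positivity
    nlinarith
  · have hx : γ * hRatio 1 γ = γ ^ 2 / (y + 2) := by
      rw [hRatio, h1, h2, hya]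
      field_simp
    rw [hx]
    refine ⟨by positivity, ?_⟩
    have hz : 0 < γ ^ 2 * ((y + 2) ^ 2 * γ ^ 2 + (y + 2) ^ 3 - γ ^ 4 - 4 * γ ^ 2 * (y + 2)) := by
      refine mul_pos (by positivity) ?_
      have h₁ : 0 ≤ γ ^ 2 * (y ^ 2 + y - γ ^ 2) := mul_nonneg (by positivity) (by linarith)
      have h₂ : γ ^ 2 * (y + 4) ≤ (y ^ 2 + y) * (y + 4) := by gcongr
      have h₃ : 0 < y ^ 2 + 8 * y + 8 := by positivity
      linarith
    have heq : (γ ^ 2 / (y + 2) + 1) *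
        (γ ^ 2 - (γ ^ 2 / (y + 2)) ^ 2 - (2 * ((1 : ℕ) : ℝ) + 1) * (γ ^ 2 / (y + 2)))
          + 3 * (γ ^ 2 / (y + 2))
        = γ ^ 2 * ((y + 2) ^ 2 * γ ^ 2 + (y + 2) ^ 3 - γ ^ 4 - 4 * γ ^ 2 * (y + 2))
          / (y + 2) ^ 3 := by
      push_cast
      field_simp
      ring
    rw [heq]
    positivity
end

section
/- For every real γ > 0, writing h₁ = h₁(γ), one has γ² · I₁(γ) · I₂(γ) · I₃(γ) / (−γ² + γ·h₁·(γ·h₁ + 3) − 4)³ < 0, where I₁(γ) = −γ² + γ·h₁·(γ·h₁ + 2) − 8, I₂(γ) = −γ + h₁·(γ·h₁ + 4) − 1, and I₃(γ) = −γ + h₁·(γ·h₁ + 4) + 1. (This quantity equals p·e_{pp} = p·(∂²e/∂p²)_η for the monatomic Synge energy, so the second pressure derivative of the Synge energy at constant entropy is strictly negative.) -/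
open MeasureTheory Real

open Set Filter Topology

lemma sqrt_sq_sub_sq_le {γ l : ℝ} (hγ : 0 < γ) (hl : γ < l) : √(l ^ 2 - γ ^ 2) ≤ l := by
  rw [Real.sqrt_le_left (by linarith)]
  nlinarith

lemma integrableOn_exp_neg_mul_pow (γ : ℝ) (hγ : 0 < γ) (k : ℕ) :
    IntegrableOn (fun l : ℝ => exp (-l) * l ^ k) (Ioi γ) := by
  have h := Real.GammaIntegral_convergent (s := (k : ℝ) + 1) (by positivity)
  refine (h.mono_set (Ioi_subset_Ioi hγ.le)).congr_fun (fun l _ => ?_) measurableSet_Ioi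
  simp

/-- A measurable function whose modulus is at most `l ^ k` is integrable against `exp (-l)`. -/
lemma integrableOn_exp_neg_mul_of_le (γ : ℝ) (hγ : 0 < γ) (k : ℕ) (f : ℝ → ℝ)
    (hf : Measurable f) (hle : ∀ l, γ < l → |f l| ≤ l ^ k) :
    IntegrableOn (fun l : ℝ => exp (-l) * f l) (Ioi γ) := by
  refine (integrableOn_exp_neg_mul_pow γ hγ k).mono' (by fun_prop) ?_
  refine (ae_restrict_iff' measurableSet_Ioi).2 (Eventually.of_forall fun l hl => ?_)
  rw [norm_mul, Real.norm_eq_abs, Real.norm_eq_abs, abs_of_pos (exp_pos _)]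
  exact mul_le_mul_of_nonneg_left (hle l hl) (exp_pos _).le

/-- Integration by parts against `exp (-l)` for a function vanishing at the left end point. -/
lemma integral_exp_neg_mul_eq_integral_deriv (γ : ℝ) (hγ : 0 < γ) (k : ℕ) (f f' : ℝ → ℝ)
    (hf : Continuous f) (hf0 : f γ = 0) (hderiv : ∀ l, γ < l → HasDerivAt f (f' l) l)
    (hle : ∀ l, γ < l → |f l| ≤ l ^ k)
    (hint' : IntegrableOn (fun l : ℝ => exp (-l) * f' l) (Ioi γ)) :
    ∫ l in Ioi γ, exp (-l) * f l = ∫ l in Ioi γ, exp (-l) * f' l := by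
  have hint := integrableOn_exp_neg_mul_of_le γ hγ k f hf.measurable hle
  have hlim : Tendsto (fun l : ℝ => exp (-l) * f l) atTop (𝓝 0) := by
    refine squeeze_zero_norm' ?_ (Real.tendsto_pow_mul_exp_neg_atTop_nhds_zero k)
    filter_upwards [eventually_gt_atTop γ] with l hl
    rw [norm_mul, Real.norm_eq_abs, Real.norm_eq_abs, abs_of_pos (exp_pos _), mul_comm]
    exact mul_le_mul_of_nonneg_right (hle l hl) (exp_pos _).le
  have h := integral_Ioi_of_hasDerivAt_of_tendsto (a := γ)
    (f := fun l : ℝ => exp (-l) * f l)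
    (f' := fun l : ℝ => exp (-l) * f' l - exp (-l) * f l)
    (by fun_prop)
    (fun l hl => by
      have h1 : HasDerivAt (fun l : ℝ => exp (-l)) (exp (-l) * (-1)) l :=
        (hasDerivAt_neg l).exp
      exact (h1.mul (hderiv l hl)).congr_deriv (by ring))
    (hint'.sub hint) hlim
  rw [integral_sub hint' hint, hf0] at h
  linarith

lemma hasDerivAt_sqrt_sq_sub_sq {γ l : ℝ} (hγ : 0 < γ) (hl : γ < l) :
    HasDerivAt (fun l : ℝ => √(l ^ 2 - γ ^ 2)) (l / √(l ^ 2 - γ ^ 2)) l := by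
  have hpos : 0 < l ^ 2 - γ ^ 2 := by nlinarith
  have h : HasDerivAt (fun l : ℝ => l ^ 2 - γ ^ 2) (2 * l) l := by
    simpa using (hasDerivAt_pow 2 l).sub_const (γ ^ 2)
  refine (h.sqrt hpos.ne').congr_deriv ?_
  rw [mul_div_mul_left _ _ two_ne_zero]

/-- Relations between the moments of `exp (-l) * √(l ^ 2 - γ ^ 2)` on `(γ, ∞)`: `M₀`, `M₁` are the
first two moments, `R` is the integral of `(l - γ) / (l + γ)` and `B` that of `l ^ 2 - γ ^ 2`. -/
lemma exists_moment_relations (γ : ℝ) (hγ : 0 < γ) :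
    ∃ M₀ M₁ R B : ℝ,
      M₀ = ∫ l in Ioi γ, exp (-l) * √(l ^ 2 - γ ^ 2) ∧
      B = ∫ l in Ioi γ, exp (-l) * ((l ^ 2 - γ ^ 2) * √(l ^ 2 - γ ^ 2)) ∧
      0 < M₀ ∧ 0 < M₁ ∧ B = 3 * M₁ ∧ R = 2 * (M₁ - γ * M₀) - 3 * M₀ ∧
      2 * γ * R < M₁ - γ * M₀ ∧ (M₁ - γ * M₀) ^ 2 ≤ B * R ∧
      M₁ ^ 2 ≤ M₀ * (B + γ ^ 2 * M₀) := by
  set q : ℝ → ℝ := fun l => √(l ^ 2 - γ ^ 2) with hq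
  have hqc : Continuous q := by fun_prop
  have hqm : Measurable q := hqc.measurable
  have hqle : ∀ l, γ < l → q l ≤ l := fun l hl => sqrt_sq_sub_sq_le hγ hl
  have hqpos : ∀ l, γ < l → 0 < q l := fun l hl => Real.sqrt_pos.2 (by nlinarith)
  have hqsq : ∀ l, γ < l → q l ^ 2 = l ^ 2 - γ ^ 2 := fun l hl => Real.sq_sqrt (by nlinarith)
  have i0 : IntegrableOn (fun l => exp (-l) * q l) (Ioi γ) :=
    integrableOn_exp_neg_mul_of_le γ hγ 1 _ hqm fun l hl => by
      rw [abs_of_pos (hqpos l hl), pow_one]; exact hqle l hl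
  have i1 : IntegrableOn (fun l => exp (-l) * (l * q l)) (Ioi γ) :=
    integrableOn_exp_neg_mul_of_le γ hγ 2 _ (by fun_prop) fun l hl => by
      rw [abs_of_pos (mul_pos (hγ.trans hl) (hqpos l hl))]
      nlinarith [hqle l hl]
  have bB : ∀ l, γ < l → |(l ^ 2 - γ ^ 2) * q l| ≤ l ^ 3 := fun l hl => by
    have h1 : 0 < l ^ 2 - γ ^ 2 := by nlinarith
    rw [abs_of_pos (mul_pos h1 (hqpos l hl))]
    calc (l ^ 2 - γ ^ 2) * q l ≤ l ^ 2 * l :=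
          mul_le_mul (by nlinarith) (hqle l hl) (hqpos l hl).le (by positivity)
      _ = l ^ 3 := by ring
  have iB : IntegrableOn (fun l => exp (-l) * ((l ^ 2 - γ ^ 2) * q l)) (Ioi γ) :=
    integrableOn_exp_neg_mul_of_le γ hγ 3 _ (by fun_prop) bB
  have iR : IntegrableOn (fun l => exp (-l) * ((l - γ) / (l + γ) * q l)) (Ioi γ) :=
    integrableOn_exp_neg_mul_of_le γ hγ 1 _ (by fun_prop) fun l hl => by
      have h1 : 0 < (l - γ) / (l + γ) := div_pos (by linarith) (by linarith)
      have h2 : (l - γ) / (l + γ) ≤ 1 := (div_le_one (by linarith)).2 (by linarith)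
      rw [abs_of_pos (mul_pos h1 (hqpos l hl)), pow_one]
      nlinarith [hqle l hl, hqpos l hl]
  have hpos : ∀ f : ℝ → ℝ, IntegrableOn f (Ioi γ) → (∀ l, γ < l → 0 < f l) →
      0 < ∫ l in Ioi γ, f l := fun f hf h => by
    rw [setIntegral_pos_iff_support_of_nonneg_ae
      ((ae_restrict_iff' measurableSet_Ioi).2 (Eventually.of_forall fun l hl => (h l hl).le)) hf]
    have : Function.support f ∩ Ioi γ = Ioi γ :=
      inter_eq_right.2 fun l hl => (h l hl).ne'
    simp [this]
  set M₀ := ∫ l in Ioi γ, exp (-l) * q l with hM0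
  set M₁ := ∫ l in Ioi γ, exp (-l) * (l * q l) with hM1
  set B := ∫ l in Ioi γ, exp (-l) * ((l ^ 2 - γ ^ 2) * q l) with hB
  set R := ∫ l in Ioi γ, exp (-l) * ((l - γ) / (l + γ) * q l) with hR
  have M0pos : 0 < M₀ := hpos _ i0 fun l hl => mul_pos (exp_pos _) (hqpos l hl)
  have M1pos : 0 < M₁ := hpos _ i1 fun l hl =>
    mul_pos (exp_pos _) (mul_pos (hγ.trans hl) (hqpos l hl))
  have Rpos : 0 < R := hpos _ iR fun l hl =>
    mul_pos (exp_pos _) (mul_pos (div_pos (by linarith) (by linarith)) (hqpos l hl))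
  have eB : B = 3 * M₁ := by
    have h := integral_exp_neg_mul_eq_integral_deriv γ hγ 3
      (fun l => (l ^ 2 - γ ^ 2) * q l) (fun l => 3 * (l * q l)) (by fun_prop) (by simp)
      (fun l hl => by
        have h1 : HasDerivAt (fun l : ℝ => l ^ 2 - γ ^ 2) (2 * l) l := by
          simpa using (hasDerivAt_pow 2 l).sub_const (γ ^ 2)
        refine (h1.mul (hasDerivAt_sqrt_sq_sub_sq hγ hl)).congr_deriv ?_
        change 2 * l * q l + (l ^ 2 - γ ^ 2) * (l / q l) = 3 * (l * q l)
        have := (hqpos l hl).ne'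
        rw [← hqsq l hl]
        field_simp
        ring) bB
      ((i1.const_mul 3).congr (Eventually.of_forall fun l => by ring))
    rw [hB, h, hM1, ← integral_const_mul]
    exact integral_congr_ae (Eventually.of_forall fun l => by ring)
  have em : ∫ l in Ioi γ, exp (-l) * ((l - γ) * q l) = M₁ - γ * M₀ := by
    rw [hM1, hM0, ← integral_const_mul, ← integral_sub i1 (i0.const_mul γ)]
    exact integral_congr_ae (Eventually.of_forall fun l => by ring)
  have im : IntegrableOn (fun l => exp (-l) * ((l - γ) * q l)) (Ioi γ) :=
    (i1.sub (i0.const_mul γ)).congr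
      (Eventually.of_forall fun l => by simp only [Pi.sub_apply]; ring)
  have eR : R = 2 * (M₁ - γ * M₀) - 3 * M₀ := by
    have h := integral_exp_neg_mul_eq_integral_deriv γ hγ 2
      (fun l => (l - γ) * q l) (fun l => 3 / 2 * q l + 1 / 2 * ((l - γ) / (l + γ) * q l))
      (by fun_prop) (by simp)
      (fun l hl => by
        refine (((hasDerivAt_id l).sub_const γ).mul
          (hasDerivAt_sqrt_sq_sub_sq hγ hl)).congr_deriv ?_
        change 1 * q l + (l - γ) * (l / q l) = _
        have h0 := (hqpos l hl).ne'
        have h1 : l + γ ≠ 0 := by linarith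
        have h2 : l / q l = l * q l / (l ^ 2 - γ ^ 2) := by
          rw [← hqsq l hl]; field_simp
        have h3 : l - γ ≠ 0 := by linarith
        rw [h2, show l ^ 2 - γ ^ 2 = (l - γ) * (l + γ) by ring]
        field_simp
        ring)
      (fun l hl => by
        rw [abs_of_pos (mul_pos (by linarith) (hqpos l hl))]
        nlinarith [hqle l hl, hqpos l hl])
      (((i0.const_mul (3 / 2)).add (iR.const_mul (1 / 2))).congr
        (Eventually.of_forall fun l => by simp only [Pi.add_apply]; ring))
    have h' : ∫ l in Ioi γ, exp (-l) * (3 / 2 * q l + 1 / 2 * ((l - γ) / (l + γ) * q l))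
        = 3 / 2 * M₀ + 1 / 2 * R := by
      rw [hM0, hR, ← integral_const_mul, ← integral_const_mul,
        ← integral_add (i0.const_mul _) (iR.const_mul _)]
      exact integral_congr_ae (Eventually.of_forall fun l => by ring)
    rw [em, h'] at h
    linarith
  refine ⟨M₀, M₁, R, B, rfl, rfl, M0pos, M1pos, eB, eR, ?_, ?_, ?_⟩
  · have h := hpos _ (im.sub (iR.const_mul (2 * γ))) fun l hl => by
      have h1 : 0 < l + γ := by linarith
      have h2 : exp (-l) * ((l - γ) * q l) - 2 * γ * (exp (-l) * ((l - γ) / (l + γ) * q l))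
          = exp (-l) * ((l - γ) ^ 2 / (l + γ) * q l) := by
        field_simp
        ring
      simp only [Pi.sub_apply]
      rw [h2]
      exact mul_pos (exp_pos _) (mul_pos (div_pos (by nlinarith) h1) (hqpos l hl))
    simp only [Pi.sub_apply] at h
    rw [integral_sub im (iR.const_mul _), integral_const_mul, em] at h
    linarith
  · have h : ∀ t : ℝ, 0 ≤ B - 2 * t * (M₁ - γ * M₀) + t ^ 2 * R := fun t => by
      rw [hB, hR, ← em, ← integral_const_mul, ← integral_const_mul,
        ← integral_sub iB (im.const_mul _),
        ← integral_add (by exact iB.sub (im.const_mul _)) (iR.const_mul _)]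
      refine setIntegral_nonneg measurableSet_Ioi fun l hl => ?_
      have hl' : γ < l := hl
      have h1 : 0 < l + γ := by linarith
      have h2 : exp (-l) * ((l ^ 2 - γ ^ 2) * q l) - 2 * t * (exp (-l) * ((l - γ) * q l))
          + t ^ 2 * (exp (-l) * ((l - γ) / (l + γ) * q l))
          = exp (-l) * ((l - γ) / (l + γ) * (l + γ - t) ^ 2 * q l) := by
        field_simp
        ring
      rw [h2]
      have h3 : 0 < l - γ := by linarith
      have := hqpos l hl'
      positivity
    have h1 := h ((M₁ - γ * M₀) / R)
    have h2 : B - 2 * ((M₁ - γ * M₀) / R) * (M₁ - γ * M₀) + ((M₁ - γ * M₀) / R) ^ 2 * R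
        = (B * R - (M₁ - γ * M₀) ^ 2) / R := by
      field_simp
      ring
    rw [h2, le_div_iff₀ Rpos] at h1
    linarith
  · have h : ∀ t : ℝ, 0 ≤ B - 2 * t * M₁ + (t ^ 2 + γ ^ 2) * M₀ := fun t => by
      rw [hB, hM0, hM1, ← integral_const_mul, ← integral_const_mul,
        ← integral_sub iB (i1.const_mul _),
        ← integral_add (by exact iB.sub (i1.const_mul _)) (i0.const_mul _)]
      refine setIntegral_nonneg measurableSet_Ioi fun l hl => ?_
      have h2 : exp (-l) * ((l ^ 2 - γ ^ 2) * q l) - 2 * t * (exp (-l) * (l * q l))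
          + (t ^ 2 + γ ^ 2) * (exp (-l) * q l) = exp (-l) * ((l - t) ^ 2 * q l) := by
        ring
      rw [h2]
      have := hqpos l hl
      positivity
    have h1 := h (M₁ / M₀)
    have h2 : B - 2 * (M₁ / M₀) * M₁ + ((M₁ / M₀) ^ 2 + γ ^ 2) * M₀
        = (M₀ * (B + γ ^ 2 * M₀) - M₁ ^ 2) / M₀ := by
      field_simp
      ring
    rw [h2, le_div_iff₀ M0pos] at h1
    linarith

lemma besselK_one (γ : ℝ) :
    besselK 1 γ = (∫ l in Ioi γ, exp (-l) * √(l ^ 2 - γ ^ 2)) / γ := by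
  have h : ((1 : ℕ) : ℝ) - 1 / 2 = 1 / 2 := by norm_num
  simp only [besselK, h, ← Real.sqrt_eq_rpow]
  norm_num [Nat.factorial]
  ring

lemma besselK_two (γ : ℝ) (hγ : 0 < γ) :
    besselK 2 γ =
      (∫ l in Ioi γ, exp (-l) * ((l ^ 2 - γ ^ 2) * √(l ^ 2 - γ ^ 2))) / (3 * γ ^ 2) := by
  have h : ∫ l in Ioi γ, exp (-l) * (l ^ 2 - γ ^ 2) ^ (((2 : ℕ) : ℝ) - 1 / 2)
      = ∫ l in Ioi γ, exp (-l) * ((l ^ 2 - γ ^ 2) * √(l ^ 2 - γ ^ 2)) := by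
    refine setIntegral_congr_fun measurableSet_Ioi fun l hl => ?_
    have hl' : γ < l := hl
    have hpos : 0 < l ^ 2 - γ ^ 2 := by nlinarith
    have he : ((2 : ℕ) : ℝ) - 1 / 2 = 1 + 1 / 2 := by norm_num
    simp only [he, Real.rpow_add hpos, Real.rpow_one, ← Real.sqrt_eq_rpow]
  rw [besselK, h]
  norm_num [Nat.factorial]
  ring

/-- Two-sided quadratic bounds for the ratio `K₁ / K₂`. -/
lemma hRatio_one_bounds (γ : ℝ) (hγ : 0 < γ) :
    0 < hRatio 1 γ ∧ γ * hRatio 1 γ ^ 2 + 4 * hRatio 1 γ < γ + 1 ∧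
      γ - 1 < γ * hRatio 1 γ ^ 2 + 4 * hRatio 1 γ := by
  obtain ⟨M₀, M₁, R, B, hM0, hB, M0pos, M1pos, eB, eR, hlt, hcs, hvar⟩ :=
    exists_moment_relations γ hγ
  have hh : hRatio 1 γ = γ * M₀ / M₁ := by
    rw [hRatio, besselK_one, besselK_two γ hγ, ← hM0, ← hB, eB]
    field_simp
  have he : γ * (γ * M₀ / M₁) ^ 2 + 4 * (γ * M₀ / M₁)
      = (γ ^ 3 * M₀ ^ 2 + 4 * γ * M₀ * M₁) / M₁ ^ 2 := by
    field_simp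
  rw [hh, he]
  subst eB
  refine ⟨by positivity, ?_, ?_⟩
  · rw [div_lt_iff₀ (by positivity)]
    have h1 := mul_lt_mul_of_pos_left hlt M1pos
    have h2 := mul_le_mul_of_nonneg_left hcs hγ.le
    subst eR
    nlinarith
  · rw [lt_div_iff₀ (by positivity)]
    have h1 := mul_le_mul_of_nonneg_left hvar hγ.le
    nlinarith [mul_pos M0pos M1pos, mul_pos hγ (mul_pos M0pos M1pos), sq_nonneg M₁]

/-- `p·e_{pp} < 0` for the monatomic Synge energy:
`γ² I₁ I₂ I₃ / (−γ² + γ h₁(γ h₁ + 3) − 4)³ < 0` for all `γ > 0`. -/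
theorem pepp_mono_neg (γ : ℝ) (hγ : 0 < γ) :
    γ ^ 2 * (-γ ^ 2 + γ * hRatio 1 γ * (γ * hRatio 1 γ + 2) - 8)
        * (-γ + hRatio 1 γ * (γ * hRatio 1 γ + 4) - 1)
        * (-γ + hRatio 1 γ * (γ * hRatio 1 γ + 4) + 1)
      / (-γ ^ 2 + γ * hRatio 1 γ * (γ * hRatio 1 γ + 3) - 4) ^ 3 < 0 := by
  obtain ⟨hpos, hup, hlow⟩ := hRatio_one_bounds γ hγ
  generalize hRatio 1 γ = h at *
  have hu : 0 < γ * h := mul_pos hγ hpos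
  have hup' : (γ * h) ^ 2 + 4 * (γ * h) < γ ^ 2 + γ := by nlinarith
  have hD : -γ ^ 2 + γ * h * (γ * h + 3) - 4 < 0 := by
    by_contra hc
    generalize γ * h = u at *
    have h1 : u < γ - 4 := by nlinarith
    nlinarith
  have hI1 : -γ ^ 2 + γ * h * (γ * h + 2) - 8 < 0 := by
    nlinarith
  have hI2 : -γ + h * (γ * h + 4) - 1 < 0 := by nlinarith
  have hI3 : 0 < -γ + h * (γ * h + 4) + 1 := by nlinarith
  refine div_neg_of_pos_of_neg ?_ (Odd.pow_neg (by decide) hD)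
  exact mul_pos (mul_pos_of_neg_of_neg (mul_neg_of_pos_of_neg (by positivity) hI1) hI2) hI3
end

section
/- For every real γ > 0, writing h₀ = h₀(γ), one has f_dia(γ) := γ⁵·(h₀² − 1)³ + 4γ⁴·h₀·(h₀² − 1)² − 32γ²·h₀·(h₀² − 1) − 24γ·h₀² + γ³·(−4h₀⁴ + 11h₀² − 7) + 16h₀ > 0. -/
open MeasureTheory Real

open Set Filter Topology

namespace BesselRatio

/-- Integrals against the measure `e^{-l} / √(l² - γ²) dl` on `(γ, ∞)`. -/
noncomputable def moment (γ : ℝ) (w : ℝ → ℝ) : ℝ :=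
  ∫ l in Ioi γ, exp (-l) * w l / √(l ^ 2 - γ ^ 2)

lemma sq_sub_sq_pos {γ l : ℝ} (hγ : 0 < γ) (hl : γ < l) : 0 < l ^ 2 - γ ^ 2 := by
  nlinarith

lemma integrableOn_exp_neg_half_div_sqrt {γ : ℝ} (hγ : 0 < γ) :
    IntegrableOn (fun l => exp (-(l / 2)) / √(l ^ 2 - γ ^ 2)) (Ioi γ) := by
  have h₁ : IntegrableOn (fun u : ℝ => u ^ (-(1 / 2) : ℝ) * exp (-(1 / 2) * u ^ (1 : ℝ)))
      (Ioi 0) :=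
    integrableOn_rpow_mul_exp_neg_mul_rpow (by norm_num) one_pos (by norm_num)
  have h₂ : IntegrableOn
      (fun l : ℝ => (l - γ) ^ (-(1 / 2) : ℝ) * exp (-(1 / 2) * (l - γ) ^ (1 : ℝ))) (Ioi γ) := by
    have h := (measurePreserving_sub_right (volume : Measure ℝ) γ).integrableOn_comp_preimage
      (measurableEmbedding_subRight γ) |>.mpr h₁
    simpa [Function.comp_def] using h
  refine (h₂.const_mul (1 / √(2 * γ))).mono'
    (Measurable.aestronglyMeasurable (by fun_prop)) ?_
  refine (ae_restrict_iff' measurableSet_Ioi).mpr (ae_of_all _ fun l hl => ?_)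
  have hl : γ < l := hl
  have hu : 0 < l - γ := sub_pos.mpr hl
  have hsqrt : √(2 * γ) * √(l - γ) ≤ √(l ^ 2 - γ ^ 2) := by
    rw [← Real.sqrt_mul (by positivity)]
    exact Real.sqrt_le_sqrt (by nlinarith)
  have hexp : exp (-(l / 2)) ≤ exp (-(1 / 2) * (l - γ)) := exp_le_exp.mpr (by linarith)
  have hs : 0 < √(2 * γ) * √(l - γ) := by positivity
  rw [Real.norm_of_nonneg (by positivity), rpow_one, rpow_neg hu.le, ← sqrt_eq_rpow]
  calc exp (-(l / 2)) / √(l ^ 2 - γ ^ 2)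
      ≤ exp (-(1 / 2) * (l - γ)) / (√(2 * γ) * √(l - γ)) := by gcongr
    _ = 1 / √(2 * γ) * ((√(l - γ))⁻¹ * exp (-(1 / 2) * (l - γ))) := by
        field_simp

lemma integrableOn_moment {γ : ℝ} (hγ : 0 < γ) {w : ℝ → ℝ} (hw : Measurable w) (M : ℝ)
    (hM : ∀ l, γ < l → |w l| ≤ M * exp (l / 2)) :
    IntegrableOn (fun l => exp (-l) * w l / √(l ^ 2 - γ ^ 2)) (Ioi γ) := by
  refine ((integrableOn_exp_neg_half_div_sqrt hγ).const_mul M).mono'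
    (Measurable.aestronglyMeasurable (by fun_prop)) ?_
  refine (ae_restrict_iff' measurableSet_Ioi).mpr (ae_of_all _ fun l hl => ?_)
  rw [norm_div, norm_mul, Real.norm_of_nonneg (exp_pos _).le,
    Real.norm_of_nonneg (Real.sqrt_nonneg _), Real.norm_eq_abs]
  calc exp (-l) * |w l| / √(l ^ 2 - γ ^ 2)
      ≤ exp (-l) * (M * exp (l / 2)) / √(l ^ 2 - γ ^ 2) := by gcongr; exact hM l hl
    _ = M * (exp (-l) * exp (l / 2)) / √(l ^ 2 - γ ^ 2) := by ring
    _ = M * (exp (-(l / 2)) / √(l ^ 2 - γ ^ 2)) := by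
        rw [← exp_add, mul_div_assoc]; congr 4; ring

lemma integrableOn_moment_one {γ : ℝ} (hγ : 0 < γ) :
    IntegrableOn (fun l => exp (-l) * 1 / √(l ^ 2 - γ ^ 2)) (Ioi γ) :=
  integrableOn_moment hγ measurable_const 1 fun l hl => by
    rw [abs_one, one_mul]; exact one_le_exp (by linarith)

lemma integrableOn_moment_id {γ : ℝ} (hγ : 0 < γ) :
    IntegrableOn (fun l => exp (-l) * l / √(l ^ 2 - γ ^ 2)) (Ioi γ) :=
  integrableOn_moment hγ measurable_id 2 fun l hl => by
    rw [abs_of_pos (by linarith)]; linarith [add_one_le_exp (l / 2)]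

lemma integrableOn_moment_sq {γ : ℝ} (hγ : 0 < γ) :
    IntegrableOn (fun l => exp (-l) * (l ^ 2 - γ ^ 2) / √(l ^ 2 - γ ^ 2)) (Ioi γ) :=
  integrableOn_moment (w := fun l => l ^ 2 - γ ^ 2) hγ (by fun_prop) 8 fun l hl => by
    rw [abs_of_pos (sq_sub_sq_pos hγ hl)]
    nlinarith [quadratic_le_exp_of_nonneg (show 0 ≤ l / 2 by linarith)]

lemma integrableOn_moment_inv {γ : ℝ} (hγ : 0 < γ) :
    IntegrableOn (fun l => exp (-l) * (l + γ)⁻¹ / √(l ^ 2 - γ ^ 2)) (Ioi γ) :=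
  integrableOn_moment (w := fun l => (l + γ)⁻¹) hγ (by fun_prop) (2 * γ)⁻¹ fun l hl => by
    have hl' : 0 < l + γ := by linarith
    rw [abs_of_pos (by positivity)]
    calc (l + γ)⁻¹ ≤ (2 * γ)⁻¹ * 1 := by rw [mul_one]; gcongr; linarith
      _ ≤ (2 * γ)⁻¹ * exp (l / 2) := by gcongr; exact one_le_exp (by linarith)

lemma moment_pos {γ : ℝ} (hγ : 0 < γ) {w : ℝ → ℝ} (hw : ∀ l, γ < l → 0 < w l)
    (hi : IntegrableOn (fun l => exp (-l) * w l / √(l ^ 2 - γ ^ 2)) (Ioi γ)) :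
    0 < moment γ w := by
  have hpos : ∀ l ∈ Ioi γ, 0 < exp (-l) * w l / √(l ^ 2 - γ ^ 2) := fun l hl =>
    div_pos (mul_pos (exp_pos _) (hw l hl)) (Real.sqrt_pos.mpr (sq_sub_sq_pos hγ hl))
  rw [moment, setIntegral_pos_iff_support_of_nonneg_ae
    ((ae_restrict_iff' measurableSet_Ioi).mpr (ae_of_all _ fun l hl => (hpos l hl).le)) hi]
  rw [inter_eq_right.mpr fun l hl => Function.mem_support.mpr (hpos l hl).ne']
  simp

lemma sqrt_sq_sub_sq_le {γ l : ℝ} (hl : 0 ≤ l) : √(l ^ 2 - γ ^ 2) ≤ l :=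
  Real.sqrt_le_iff.mpr ⟨hl, by nlinarith [sq_nonneg γ]⟩

lemma hasDerivAt_sqrt_sq_sub_sq {γ l : ℝ} (hγ : 0 < γ) (hl : γ < l) :
    HasDerivAt (fun l => √(l ^ 2 - γ ^ 2)) (l / √(l ^ 2 - γ ^ 2)) l := by
  refine (((hasDerivAt_pow 2 l).sub_const (γ ^ 2)).sqrt (sq_sub_sq_pos hγ hl).ne').congr_deriv ?_
  rw [Nat.cast_ofNat, Nat.add_one_sub_one, pow_one, mul_div_mul_left _ _ two_ne_zero]

lemma hasDerivAt_exp_neg (l : ℝ) : HasDerivAt (fun l => exp (-l)) (-exp (-l)) l := by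
  simpa using (hasDerivAt_id l).neg.exp

/-- Integration by parts relates the two integral representations of `K₁`. -/
lemma moment_id_eq_moment_sq {γ : ℝ} (hγ : 0 < γ) :
    moment γ (fun l => l) = moment γ (fun l => l ^ 2 - γ ^ 2) := by
  have hlim : Tendsto (fun l => exp (-l) * √(l ^ 2 - γ ^ 2)) atTop (𝓝 0) := by
    have h : Tendsto (fun l : ℝ => l ^ 1 * exp (-l)) atTop (𝓝 0) :=
      tendsto_pow_mul_exp_neg_atTop_nhds_zero 1
    refine tendsto_of_tendsto_of_tendsto_of_le_of_le' tendsto_const_nhds h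
      (Eventually.of_forall fun l => by positivity) ?_
    filter_upwards [eventually_ge_atTop 0] with l hl
    rw [pow_one, mul_comm]
    gcongr
    exact sqrt_sq_sub_sq_le hl
  have h := integral_Ioi_of_hasDerivAt_of_tendsto
    (f := fun l => exp (-l) * √(l ^ 2 - γ ^ 2))
    (f' := fun l => exp (-l) * l / √(l ^ 2 - γ ^ 2)
      - exp (-l) * (l ^ 2 - γ ^ 2) / √(l ^ 2 - γ ^ 2))
    (a := γ) (m := 0) (Continuous.continuousWithinAt (by fun_prop))
    (fun l hl => by
      refine ((hasDerivAt_exp_neg l).mul (hasDerivAt_sqrt_sq_sub_sq hγ hl)).congr_deriv ?_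
      rw [mul_div_assoc _ (l ^ 2 - γ ^ 2), Real.div_sqrt]
      ring)
    ((integrableOn_moment_id hγ).sub (integrableOn_moment_sq hγ)) hlim
  rw [integral_sub (integrableOn_moment_id hγ) (integrableOn_moment_sq hγ)] at h
  simp only [sub_self, Real.sqrt_zero, mul_zero] at h
  exact sub_eq_zero.mp h

lemma moment_id_sub {γ : ℝ} (hγ : 0 < γ) :
    moment γ (fun l => l) - γ * moment γ (fun _ => 1) = γ * moment γ (fun l => (l + γ)⁻¹) := by
  have hlim : Tendsto (fun l => exp (-l) * (√(l ^ 2 - γ ^ 2) / (l + γ))) atTop (𝓝 0) := by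
    refine tendsto_of_tendsto_of_tendsto_of_le_of_le' tendsto_const_nhds
      (tendsto_exp_neg_atTop_nhds_zero) ?_ ?_
    · filter_upwards [eventually_ge_atTop 0] with l hl
      positivity
    · filter_upwards [eventually_ge_atTop 0] with l hl
      refine mul_le_of_le_one_right (exp_pos _).le ((div_le_one (by positivity)).mpr ?_)
      linarith [sqrt_sq_sub_sq_le (γ := γ) hl]
  have i₁ := integrableOn_moment_one hγ
  have i₂ := integrableOn_moment_id hγ
  have i₃ := integrableOn_moment_inv hγ
  have i₄ : IntegrableOn (fun l => exp (-l) * l / √(l ^ 2 - γ ^ 2)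
      - γ * (exp (-l) * 1 / √(l ^ 2 - γ ^ 2))) (Ioi γ) := i₂.sub (i₁.const_mul γ)
  have h := integral_Ioi_of_hasDerivAt_of_tendsto
    (f := fun l => exp (-l) * (√(l ^ 2 - γ ^ 2) / (l + γ)))
    (f' := fun l => γ * (exp (-l) * (l + γ)⁻¹ / √(l ^ 2 - γ ^ 2))
      - (exp (-l) * l / √(l ^ 2 - γ ^ 2) - γ * (exp (-l) * 1 / √(l ^ 2 - γ ^ 2))))
    (a := γ) (m := 0)
    (ContinuousAt.continuousWithinAt (by
      have : γ + γ ≠ 0 := by positivity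
      fun_prop (disch := assumption)))
    (fun l hl => by
      have hl : γ < l := hl
      have hne : l + γ ≠ 0 := by linarith
      have hS := Real.sqrt_pos.mpr (sq_sub_sq_pos hγ hl)
      have hS2 := Real.sq_sqrt (sq_sub_sq_pos hγ hl).le
      refine ((hasDerivAt_exp_neg l).mul ((hasDerivAt_sqrt_sq_sub_sq hγ hl).div
        ((hasDerivAt_id' l).add_const γ) hne)).congr_deriv ?_
      simp only [Pi.div_apply]
      generalize √(l ^ 2 - γ ^ 2) = S at hS hS2 ⊢
      field_simp
      rw [hS2]
      ring)
    ((i₃.const_mul γ).sub i₄) hlim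
  rw [integral_sub (i₃.const_mul γ) i₄,
    integral_sub i₂ (i₁.const_mul γ), integral_const_mul, integral_const_mul] at h
  simp only [sub_self, Real.sqrt_zero, zero_div, mul_zero] at h
  exact (sub_eq_zero.mp h).symm

lemma besselK_zero {γ : ℝ} (hγ : 0 < γ) : besselK 0 γ = moment γ (fun _ => 1) := by
  have h : ∀ l ∈ Ioi γ, exp (-l) * (l ^ 2 - γ ^ 2) ^ (((0 : ℕ) : ℝ) - 1 / 2)
      = exp (-l) * 1 / √(l ^ 2 - γ ^ 2) := fun l hl => by
    rw [Nat.cast_zero, zero_sub, rpow_neg (sq_sub_sq_pos hγ hl).le, ← sqrt_eq_rpow, mul_one,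
      div_eq_mul_inv]
  rw [besselK, moment, setIntegral_congr_fun measurableSet_Ioi h]
  simp

lemma besselK_one {γ : ℝ} (hγ : 0 < γ) : besselK 1 γ = moment γ (fun l => l) / γ := by
  have h : ∀ l ∈ Ioi γ, exp (-l) * (l ^ 2 - γ ^ 2) ^ (((1 : ℕ) : ℝ) - 1 / 2)
      = exp (-l) * (l ^ 2 - γ ^ 2) / √(l ^ 2 - γ ^ 2) := fun l _ => by
    rw [mul_div_assoc, Real.div_sqrt, sqrt_eq_rpow]
    norm_num
  rw [moment_id_eq_moment_sq hγ, besselK, moment, setIntegral_congr_fun measurableSet_Ioi h]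
  norm_num [Nat.factorial]
  ring

lemma moment_id_lt {γ : ℝ} (hγ : 0 < γ) :
    2 * moment γ (fun l => l) < (2 * γ + 1) * moment γ (fun _ => 1) := by
  have i₁ := integrableOn_moment_one hγ
  have i₃ := integrableOn_moment_inv hγ
  have heq : (fun l => exp (-l) * (1 - 2 * γ * (l + γ)⁻¹) / √(l ^ 2 - γ ^ 2)) =
      fun l => exp (-l) * 1 / √(l ^ 2 - γ ^ 2)
        - 2 * γ * (exp (-l) * (l + γ)⁻¹ / √(l ^ 2 - γ ^ 2)) := by
    funext l; ring
  have hpos : 0 < moment γ (fun l => 1 - 2 * γ * (l + γ)⁻¹) := by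
    refine moment_pos hγ (fun l hl => ?_) (heq ▸ i₁.sub (i₃.const_mul (2 * γ)))
    rw [sub_pos, ← div_eq_mul_inv, div_lt_one (by linarith)]
    linarith
  rw [moment, heq, integral_sub i₁ (i₃.const_mul (2 * γ)), integral_const_mul] at hpos
  change 0 < moment γ (fun _ => 1) - 2 * γ * moment γ (fun l => (l + γ)⁻¹) at hpos
  linarith [moment_id_sub hγ]

lemma lt_moment_id {γ : ℝ} (hγ : 0 < γ) :
    (4 * γ + 3) * γ * moment γ (fun _ => 1) < (4 * γ + 1) * moment γ (fun l => l) := by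
  have i₁ := integrableOn_moment_one hγ
  have i₂ := integrableOn_moment_id hγ
  have i₃ := integrableOn_moment_inv hγ
  have i₄ : IntegrableOn (fun l => exp (-l) * l / √(l ^ 2 - γ ^ 2)
      - 3 * γ * (exp (-l) * 1 / √(l ^ 2 - γ ^ 2))) (Ioi γ) := i₂.sub (i₁.const_mul (3 * γ))
  have heq : (fun l => exp (-l) * (4 * γ ^ 2 * (l + γ)⁻¹ + (l - 3 * γ)) / √(l ^ 2 - γ ^ 2)) =
      fun l => 4 * γ ^ 2 * (exp (-l) * (l + γ)⁻¹ / √(l ^ 2 - γ ^ 2))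
        + (exp (-l) * l / √(l ^ 2 - γ ^ 2)
          - 3 * γ * (exp (-l) * 1 / √(l ^ 2 - γ ^ 2))) := by
    funext l; ring
  have hpos : 0 < moment γ (fun l => 4 * γ ^ 2 * (l + γ)⁻¹ + (l - 3 * γ)) := by
    refine moment_pos hγ (fun l hl => ?_) (heq ▸ (i₃.const_mul (4 * γ ^ 2)).add i₄)
    have h₁ : 0 < l + γ := by linarith
    have h₂ : 0 < l - γ := by linarith
    have h₃ : 4 * γ ^ 2 * (l + γ)⁻¹ + (l - 3 * γ) = (l - γ) ^ 2 / (l + γ) := by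
      field_simp
      ring
    rw [h₃]
    positivity
  rw [moment, heq, integral_add (i₃.const_mul (4 * γ ^ 2)) i₄,
    integral_sub i₂ (i₁.const_mul (3 * γ)), integral_const_mul, integral_const_mul] at hpos
  change 0 < 4 * γ ^ 2 * moment γ (fun l => (l + γ)⁻¹)
    + (moment γ (fun l => l) - 3 * γ * moment γ (fun _ => 1)) at hpos
  linear_combination hpos - 4 * γ * moment_id_sub hγ

lemma moment_id_pos {γ : ℝ} (hγ : 0 < γ) : 0 < moment γ (fun l => l) :=
  moment_pos hγ (fun _ hl => hγ.trans hl) (integrableOn_moment_id hγ)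

lemma hRatio_zero {γ : ℝ} (hγ : 0 < γ) :
    hRatio 0 γ = γ * moment γ (fun _ => 1) / moment γ (fun l => l) := by
  rw [hRatio, zero_add, besselK_zero hγ, besselK_one hγ, div_div_eq_mul_div, mul_comm γ]

lemma two_mul_div_lt_hRatio {γ : ℝ} (hγ : 0 < γ) : 2 * γ / (2 * γ + 1) < hRatio 0 γ := by
  rw [hRatio_zero hγ, div_lt_div_iff₀ (by positivity) (moment_id_pos hγ)]
  linear_combination γ * moment_id_lt hγ

lemma hRatio_lt_div {γ : ℝ} (hγ : 0 < γ) : hRatio 0 γ < (4 * γ + 1) / (4 * γ + 3) := by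
  rw [hRatio_zero hγ, div_lt_div_iff₀ (moment_id_pos hγ) (by positivity)]
  linear_combination lt_moment_id hγ

end BesselRatio

open BesselRatio

/-- For every `γ > 0`, `f_dia(γ) > 0` where `h₀ = K₀(γ)/K₁(γ)`. -/
theorem f_dia_pos (γ : ℝ) (hγ : 0 < γ) :
    γ ^ 5 * (hRatio 0 γ ^ 2 - 1) ^ 3
      + 4 * γ ^ 4 * hRatio 0 γ * (hRatio 0 γ ^ 2 - 1) ^ 2
      - 32 * γ ^ 2 * hRatio 0 γ * (hRatio 0 γ ^ 2 - 1)
      - 24 * γ * hRatio 0 γ ^ 2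
      + γ ^ 3 * (-4 * hRatio 0 γ ^ 4 + 11 * hRatio 0 γ ^ 2 - 7)
      + 16 * hRatio 0 γ > 0 := by
  have hL := two_mul_div_lt_hRatio hγ
  have hU := hRatio_lt_div hγ
  generalize hRatio 0 γ = h at hL hU ⊢
  obtain ⟨s, hs, rfl⟩ : ∃ s : ℝ, 0 < s ∧ (2 * γ * (4 * γ + 3) + s * ((4 * γ + 1) * (2 * γ + 1)))
      / ((4 * γ + 3) * (2 * γ + 1) * (1 + s)) = h := by
    rw [div_lt_iff₀ (by positivity)] at hL
    rw [lt_div_iff₀ (by positivity)] at hU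
    have h₁ : 0 < h * (2 * γ + 1) - 2 * γ := by linarith
    have h₂ : 0 < 4 * γ + 1 - h * (4 * γ + 3) := by linarith
    refine ⟨(h * (2 * γ + 1) - 2 * γ) * (4 * γ + 3)
      / ((4 * γ + 1 - h * (4 * γ + 3)) * (2 * γ + 1)), by positivity, ?_⟩
    rw [div_eq_iff (by positivity)]
    generalize he : 4 * γ + 1 - h * (4 * γ + 3) = e at h₂
    field_simp
    rw [← he]
    ring
  set N := 2 * γ * (4 * γ + 3) + s * ((4 * γ + 1) * (2 * γ + 1)) with hN
  set D := (4 * γ + 3) * (2 * γ + 1) * (1 + s) with hD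
  have hD0 : 0 < D := by positivity
  have hP : 0 < γ ^ 5 * (N ^ 2 - D ^ 2) ^ 3 + 4 * γ ^ 4 * N * D * (N ^ 2 - D ^ 2) ^ 2
      - 32 * γ ^ 2 * N * D ^ 3 * (N ^ 2 - D ^ 2) - 24 * γ * N ^ 2 * D ^ 4
      + γ ^ 3 * (-4 * N ^ 4 * D ^ 2 + 11 * N ^ 2 * D ^ 4 - 7 * D ^ 6) + 16 * N * D ^ 5 := by
    rw [hN, hD]
    ring_nf
    positivity
  refine (div_pos hP (pow_pos hD0 6)).trans_eq ?_
  clear_value N D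
  field_simp
end

section
/- For every real γ with γ₀ < γ ≤ √2, one has K₀(γ)/K₁(γ) ≥ γ/2, where γ₀ = 2·exp(−C_E) and C_E is the Euler–Mascheroni constant. -/
open MeasureTheory Real

/-- The integrand `e^{-l} (l² - γ²)^{-1/2}` of `K₀` is integrable on `(γ, ∞)`. -/
lemma integrableOn_exp_neg_mul_rpow_neg_half {γ : ℝ} (hγ : 0 < γ) :
    IntegrableOn (fun l => exp (-l) * (l ^ 2 - γ ^ 2) ^ (-(1 / 2) : ℝ)) (Set.Ioi γ) := by
  have hΓ : IntegrableOn (fun x : ℝ => exp (-x) * x ^ ((1 / 2 : ℝ) - 1)) (Set.Ioi 0) :=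
    GammaIntegral_convergent (by norm_num)
  have hshift : IntegrableOn
      (fun l : ℝ => exp (-(l - γ)) * (l - γ) ^ ((1 / 2 : ℝ) - 1)) (Set.Ioi γ) := by
    have h := (measurePreserving_sub_right volume γ).integrableOn_comp_preimage
      (measurableEmbedding_subRight γ) (f := fun x : ℝ => exp (-x) * x ^ ((1 / 2 : ℝ) - 1))
      (s := Set.Ioi 0)
    simpa [Function.comp_def] using h.2 hΓ
  refine (hshift.const_mul ((2 * γ) ^ (-(1 / 2) : ℝ))).mono' ?_ ?_
  · exact (by fun_prop : Measurable fun l : ℝ =>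
      exp (-l) * (l ^ 2 - γ ^ 2) ^ (-(1 / 2) : ℝ)).aestronglyMeasurable
  · refine (ae_restrict_mem measurableSet_Ioi).mono fun l (hl : γ < l) => ?_
    have hd : 0 < l - γ := sub_pos.2 hl
    have hs : 0 < l ^ 2 - γ ^ 2 := by nlinarith
    rw [norm_of_nonneg (mul_nonneg (exp_pos _).le (rpow_nonneg hs.le _))]
    have hpow : (l ^ 2 - γ ^ 2) ^ (-(1 / 2) : ℝ)
        ≤ (2 * γ) ^ (-(1 / 2) : ℝ) * (l - γ) ^ (-(1 / 2) : ℝ) := by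
      rw [← mul_rpow (by positivity) hd.le]
      exact rpow_le_rpow_of_nonpos (by positivity) (by nlinarith) (by norm_num)
    calc exp (-l) * (l ^ 2 - γ ^ 2) ^ (-(1 / 2) : ℝ)
        ≤ exp (-(l - γ)) * ((2 * γ) ^ (-(1 / 2) : ℝ) * (l - γ) ^ (-(1 / 2) : ℝ)) :=
          mul_le_mul (exp_le_exp.2 (by linarith)) hpow (rpow_nonneg hs.le _) (exp_pos _).le
      _ = _ := by norm_num; ring

/-- The integrand `e^{-l} (l² - γ²)^{1/2}` of `K₁` is integrable on `(γ, ∞)`. -/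
lemma integrableOn_exp_neg_mul_sqrt {γ : ℝ} (hγ : 0 < γ) :
    IntegrableOn (fun l => exp (-l) * √(l ^ 2 - γ ^ 2)) (Set.Ioi γ) := by
  have hΓ : IntegrableOn (fun x : ℝ => exp (-x) * x ^ ((2 : ℝ) - 1)) (Set.Ioi 0) :=
    GammaIntegral_convergent (by norm_num)
  refine (hΓ.mono_set (Set.Ioi_subset_Ioi hγ.le)).mono' ?_ ?_
  · exact (by fun_prop : Measurable fun l : ℝ =>
      exp (-l) * √(l ^ 2 - γ ^ 2)).aestronglyMeasurable
  · refine (ae_restrict_mem measurableSet_Ioi).mono fun l (hl : γ < l) => ?_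
    rw [norm_of_nonneg (by positivity), show (2 : ℝ) - 1 = 1 by norm_num, rpow_one]
    gcongr
    exact sqrt_le_iff.2 ⟨by linarith, by nlinarith⟩

/-- The integrand `e^{-l} l / √(l² - γ²)` is integrable on `(γ, ∞)`. -/
lemma integrableOn_exp_neg_mul_div_sqrt {γ : ℝ} (hγ : 0 < γ) :
    IntegrableOn (fun l => exp (-l) * (l / √(l ^ 2 - γ ^ 2))) (Set.Ioi γ) := by
  refine (((integrableOn_exp_neg_mul_rpow_neg_half hγ).const_mul γ).add
    (integrableOn_exp_neg_mul_sqrt hγ |>.const_mul γ⁻¹)).mono' ?_ ?_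
  · exact (by fun_prop : Measurable fun l : ℝ =>
      exp (-l) * (l / √(l ^ 2 - γ ^ 2))).aestronglyMeasurable
  · refine (ae_restrict_mem measurableSet_Ioi).mono fun l (hl : γ < l) => ?_
    have hs : 0 < l ^ 2 - γ ^ 2 := by nlinarith
    have hl0 : 0 < l := hγ.trans hl
    have hsq := sq_sqrt hs.le
    have hsp := sqrt_pos.2 hs
    simp only [Pi.add_apply]
    rw [norm_of_nonneg (by positivity), rpow_neg hs.le, ← sqrt_eq_rpow]
    set s := √(l ^ 2 - γ ^ 2)
    have key : l / s ≤ γ * s⁻¹ + γ⁻¹ * s := by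
      rw [show γ * s⁻¹ + γ⁻¹ * s = ((γ ^ 2 + s ^ 2) / γ) / s by field_simp]
      gcongr
      rw [le_div_iff₀ hγ]
      nlinarith
    calc exp (-l) * (l / s) ≤ exp (-l) * (γ * s⁻¹ + γ⁻¹ * s) := by gcongr
      _ = _ := by ring

/-- Integration by parts: the total derivative of `e^{-l} √(l² - γ²)` integrates to zero. -/
lemma integral_exp_neg_mul_div_sqrt {γ : ℝ} (hγ : 0 < γ) :
    ∫ l in Set.Ioi γ, exp (-l) * (l / √(l ^ 2 - γ ^ 2))
      = ∫ l in Set.Ioi γ, exp (-l) * √(l ^ 2 - γ ^ 2) := by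
  have hI := (integrableOn_exp_neg_mul_div_sqrt hγ).sub (integrableOn_exp_neg_mul_sqrt hγ)
  have hderiv : ∀ l ∈ Set.Ioi γ, HasDerivAt (fun l => exp (-l) * √(l ^ 2 - γ ^ 2))
      (exp (-l) * (l / √(l ^ 2 - γ ^ 2)) - exp (-l) * √(l ^ 2 - γ ^ 2)) l := by
    intro l (hl : γ < l)
    have hs : 0 < l ^ 2 - γ ^ 2 := by nlinarith
    have hsp := sqrt_pos.2 hs
    refine (((hasDerivAt_neg l).exp).mul
      (((hasDerivAt_pow 2 l).sub_const (γ ^ 2)).sqrt hs.ne')).congr_deriv ?_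
    field_simp
    ring
  have htend : Filter.Tendsto (fun l => exp (-l) * √(l ^ 2 - γ ^ 2)) Filter.atTop (nhds 0) :=
    tendsto_zero_of_hasDerivAt_of_integrableOn_Ioi hderiv hI
      (integrableOn_exp_neg_mul_sqrt hγ)
  have h := integral_Ioi_of_hasDerivAt_of_tendsto
    (by fun_prop : Continuous fun l : ℝ => exp (-l) * √(l ^ 2 - γ ^ 2)).continuousWithinAt
    hderiv hI htend
  rw [integral_sub (integrableOn_exp_neg_mul_div_sqrt hγ) (integrableOn_exp_neg_mul_sqrt hγ)] at h
  simpa [sub_eq_zero] using h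

/-- Nonnegativity of `∫ e^{-l} (l - 2)² / √(l² - γ²)` as a relation between the two integrals. -/
lemma three_mul_integral_exp_neg_mul_sqrt_le {γ : ℝ} (hγ : 0 < γ) :
    3 * ∫ l in Set.Ioi γ, exp (-l) * √(l ^ 2 - γ ^ 2)
      ≤ (4 + γ ^ 2) * ∫ l in Set.Ioi γ, exp (-l) * (l ^ 2 - γ ^ 2) ^ (-(1 / 2) : ℝ) := by
  have hA := (integrableOn_exp_neg_mul_rpow_neg_half hγ).const_mul (4 + γ ^ 2)
  have hB := integrableOn_exp_neg_mul_sqrt hγ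
  have hC := (integrableOn_exp_neg_mul_div_sqrt hγ).const_mul 4
  have hle := setIntegral_mono_on hC (hA.add hB) measurableSet_Ioi fun l (hl : γ < l) => by
    have hs : 0 < l ^ 2 - γ ^ 2 := by nlinarith
    have hsq := sq_sqrt hs.le
    have hsp := sqrt_pos.2 hs
    simp only [Pi.add_apply]
    rw [rpow_neg hs.le, ← sqrt_eq_rpow]
    set s := √(l ^ 2 - γ ^ 2)
    have key : 4 * (l / s) ≤ (4 + γ ^ 2) * s⁻¹ + s := by
      rw [show (4 + γ ^ 2) * s⁻¹ + s = (4 + γ ^ 2 + s ^ 2) / s by field_simp, ← mul_div_assoc]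
      gcongr
      nlinarith [sq_nonneg (l - 2)]
    calc 4 * (exp (-l) * (l / s)) = exp (-l) * (4 * (l / s)) := by ring
      _ ≤ exp (-l) * ((4 + γ ^ 2) * s⁻¹ + s) := by gcongr
      _ = _ := by ring
  simp only [Pi.add_apply] at hle
  rw [integral_add hA hB, integral_const_mul, integral_const_mul,
    integral_exp_neg_mul_div_sqrt hγ] at hle
  linarith

lemma integral_exp_neg_mul_sqrt_pos {γ : ℝ} (hγ : 0 < γ) :
    0 < ∫ l in Set.Ioi γ, exp (-l) * √(l ^ 2 - γ ^ 2) := by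
  rw [setIntegral_pos_iff_support_of_nonneg_ae (ae_of_all _ fun l => by positivity)
    (integrableOn_exp_neg_mul_sqrt hγ)]
  have hsub : Set.Ioi γ ⊆ Function.support (fun l => exp (-l) * √(l ^ 2 - γ ^ 2)) := by
    intro l (hl : γ < l)
    have hs : 0 < l ^ 2 - γ ^ 2 := by nlinarith
    exact (mul_pos (exp_pos _) (sqrt_pos.2 hs)).ne'
  rw [Set.inter_eq_self_of_subset_right hsub]
  simp

/-- For `γ₀ < γ ≤ √2` (with `γ₀ = 2 e^{-C_E}`), `K₀(γ)/K₁(γ) ≥ γ/2`. -/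
theorem bessel_ratio_lower_mid (γ : ℝ)
    (h1 : 2 * Real.exp (-Real.eulerMascheroniConstant) < γ) (h2 : γ ≤ Real.sqrt 2) :
    besselK 0 γ / besselK 1 γ ≥ γ / 2 := by
  have hγ : 0 < γ := lt_trans (by positivity) h1
  have hsq : γ ^ 2 ≤ 2 := (le_sqrt hγ.le (by norm_num)).1 h2
  have hB := integral_exp_neg_mul_sqrt_pos hγ
  have hle := three_mul_integral_exp_neg_mul_sqrt_le hγ
  have hK₀ : besselK 0 γ
      = ∫ l in Set.Ioi γ, exp (-l) * (l ^ 2 - γ ^ 2) ^ (-(1 / 2) : ℝ) := by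
    simp [besselK]
  have hK₁ : besselK 1 γ = γ⁻¹ * ∫ l in Set.Ioi γ, exp (-l) * √(l ^ 2 - γ ^ 2) := by
    simp only [besselK, sqrt_eq_rpow]
    norm_num [Nat.factorial]
  rw [hK₀, hK₁, ge_iff_le, le_div_iff₀ (by positivity)]
  set A := ∫ l in Set.Ioi γ, exp (-l) * (l ^ 2 - γ ^ 2) ^ (-(1 / 2) : ℝ)
  set B := ∫ l in Set.Ioi γ, exp (-l) * √(l ^ 2 - γ ^ 2)
  have hA : 0 < A := pos_of_mul_pos_right (by linarith : 0 < (4 + γ ^ 2) * A) (by positivity)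
  rw [show γ / 2 * (γ⁻¹ * B) = B / 2 by field_simp]
  nlinarith
end
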